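/- Let β ∈ {1,4}, and fix real parameters α > −1 and δ > −2 independent of n (corresponding to leads with m = n + C channels). For every even integer l ≥ 0 and integer k ≥ 0 with (l,k) ∉ {(0,0),(0,1),(0,2),(2,0)}, the joint cumulants of conductance and shot noise satisfy lim_{n→∞} n^{l+k−1} · κ_{l,k}^{(β)}(n) = (−1)^k (β/2 − 1) · (l+k−2)! / ((4β)^k (4β)^l) · ∑_{j=0}^{k} C(2j+l, j+l/2) · C(k,j) · (−2)^{−j}, where C(·,·) denotes the binomial coefficient. -/

import Mathlib

open MeasureTheory Filter Finset

/-- The β-deformed Vandermonde interaction factor `∏_{j<k} |T_k - T_j|^β`. -/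
noncomputable def vand (β : ℝ) {n : ℕ} (T : Fin n → ℝ) : ℝ :=
  ∏ j, ∏ k ∈ Finset.Ioi j, |T k - T j| ^ β

/-- The Jacobi-ensemble weight `∏_j T_j^α (1-T_j)^{δ/2} ∏_{j<k} |T_k-T_j|^β`. -/
noncomputable def jacW (β α δ : ℝ) (n : ℕ) (T : Fin n → ℝ) : ℝ :=
  (∏ j, T j ^ α * (1 - T j) ^ (δ / 2)) * vand β T

/-- Selberg's integral `c_n^{(β)}`. -/
noncomputable def cSel (β α δ : ℝ) (n : ℕ) : ℝ :=
  ∫ T in Set.Icc (0 : Fin n → ℝ) 1, jacW β α δ n T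

/-- The joint moment generating function `M_n^{(β)}(z,w)` of conductance and shot noise. -/
noncomputable def Mjoint (β α δ : ℝ) (n : ℕ) (z w : ℝ) : ℝ :=
  (∫ T in Set.Icc (0 : Fin n → ℝ) 1,
      Real.exp (∑ j, (-(z * T j) - w * T j * (1 - T j))) * jacW β α δ n T) / cSel β α δ n

/-- The joint cumulant generating function `σ_n^{(β)}(z,w) = log M_n^{(β)}(z,w)`. -/
noncomputable def sigJoint (β α δ : ℝ) (n : ℕ) (z w : ℝ) : ℝ :=
  Real.log (Mjoint β α δ n z w)

/-- The joint cumulants `κ_{l,k}^{(β)}(n) = (-1)^{l+k} ∂_z^l ∂_w^k σ_n^{(β)}(0,0)`. -/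
noncomputable def kappaJ (β α δ : ℝ) (l k : ℕ) (n : ℕ) : ℝ :=
  (-1 : ℝ) ^ (l + k) *
    iteratedDeriv l (fun z => iteratedDeriv k (fun w => sigJoint β α δ n z w) 0) 0

open Polynomial.Chebyshev in
theorem cheb_vector_field_eq (k : ℤ) (a : ℝ) :
    (1 - a ^ 2) * (U ℝ (k - 1)).eval a = ((T ℝ (k - 1)).eval a - (T ℝ (k + 1)).eval a) / 2 := by
  have h1 := congrArg (Polynomial.eval a) (one_sub_X_sq_mul_U_eq_pol_in_T ℝ (k - 1))
  have h2 := congrArg (Polynomial.eval a) (T_add_two ℝ (k - 1))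
  simp only [Polynomial.eval_mul, Polynomial.eval_sub, Polynomial.eval_pow, Polynomial.eval_X,
    Polynomial.eval_one, Polynomial.eval_ofNat] at h1 h2
  rw [show k - 1 + 2 = k + 1 by ring, show k - 1 + 1 = k by ring] at *
  rw [h1]; linarith

open Polynomial.Chebyshev in
theorem cheb_divided_difference (M : ℕ) (a b : ℝ) :
    (a - b) * ((T ℝ (M + 1)).eval a + (T ℝ (M + 1)).eval b
      + 2 * ∑ i ∈ range M, (T ℝ (i + 1)).eval a * (T ℝ (M - i)).eval b)
    = -((1 - a ^ 2) * (U ℝ M).eval a - (1 - b ^ 2) * (U ℝ M).eval b) := by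
  have hT : ∀ (y : ℝ) (k : ℤ), 2 * y * (T ℝ k).eval y
      = (T ℝ (k + 1)).eval y + (T ℝ (k - 1)).eval y := by
    intro y k
    have h2 := congrArg (Polynomial.eval y) (T_add_one ℝ k)
    simp only [Polynomial.eval_mul, Polynomial.eval_sub, Polynomial.eval_X,
      Polynomial.eval_ofNat] at h2
    linarith
  have hs : ∀ i ∈ range M, (a - b) * (2 * ((T ℝ (i + 1)).eval a * (T ℝ (M - i)).eval b))
      = ((T ℝ (((i + 1 : ℕ) : ℤ) + 1)).eval a * (T ℝ (M - ((i + 1 : ℕ) : ℤ) + 1)).eval b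
          - (T ℝ ((i : ℤ) + 1)).eval a * (T ℝ (M - (i : ℤ) + 1)).eval b)
        - ((T ℝ (((i + 1 : ℕ) : ℤ))).eval a * (T ℝ (M - ((i + 1 : ℕ) : ℤ))).eval b
          - (T ℝ ((i : ℤ))).eval a * (T ℝ (M - (i : ℤ))).eval b) := by
    intro i _
    have h1 := hT a (i + 1)
    have h2 := hT b (M - i)
    push_cast
    rw [show (i : ℤ) + 1 - 1 = i by ring] at h1
    rw [show (M : ℤ) - (i + 1) + 1 = M - i by ring, show (M : ℤ) - (i + 1) = M - i - 1 by ring]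
    linear_combination (T ℝ (M - i)).eval b * h1 - (T ℝ (i + 1)).eval a * h2
  have h3 := cheb_vector_field_eq (M + 1) a
  have h4 := cheb_vector_field_eq (M + 1) b
  have h5 := hT a (M + 1)
  have h6 := hT b (M + 1)
  rw [show (M : ℤ) + 1 - 1 = M by ring] at *
  rw [h3, h4, mul_add, mul_sum, mul_sum, sum_congr rfl hs, sum_sub_distrib,
    sum_range_sub (fun i : ℕ => (T ℝ ((i : ℤ) + 1)).eval a * (T ℝ (M - (i : ℤ) + 1)).eval b),
    sum_range_sub (fun i : ℕ => (T ℝ (i : ℤ)).eval a * (T ℝ (M - (i : ℤ))).eval b)]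
  simp
  linarith

open Polynomial.Chebyshev in
theorem hasDerivAt_cheb_vector_field (M : ℕ) (a : ℝ) :
    HasDerivAt (fun y => (1 - y ^ 2) * (U ℝ M).eval y)
      (-((U ℝ (M - 1)).eval a + (M + 2) * (T ℝ (M + 1)).eval a)) a := by
  have h : (fun y : ℝ => (1 - y ^ 2) * (U ℝ M).eval y)
      = fun y => ((T ℝ M).eval y - (T ℝ (M + 2)).eval y) / 2 := by
    funext y
    have := cheb_vector_field_eq (M + 1) y
    rw [show (M : ℤ) + 1 - 1 = M by ring, show (M : ℤ) + 1 + 1 = M + 2 by ring] at this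
    exact this
  rw [h]
  have h1 := (((T ℝ M).hasDerivAt a).sub ((T ℝ (M + 2)).hasDerivAt a)).div_const 2
  refine h1.congr_deriv ?_
  have h2 := congrArg (Polynomial.eval a) (two_mul_T_eq_U_sub_U ℝ (M - 1))
  rw [show (M : ℤ) - 1 + 2 = M + 1 by ring] at h2
  rw [T_derivative_eq_U, T_derivative_eq_U]
  simp only [Polynomial.eval_mul, Polynomial.eval_sub, Polynomial.eval_intCast,
      Polynomial.eval_ofNat] at h2 ⊢
  rw [show (M : ℤ) + 2 - 1 = M + 1 by ring]
  push_cast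
  linear_combination ((M : ℝ) + 2) / 2 * h2

open Polynomial.Chebyshev in
theorem cheb_divided_difference_diag (M : ℕ) (a : ℝ) :
    2 * (T ℝ (M + 1)).eval a
      + 2 * ∑ i ∈ range M, (T ℝ (i + 1)).eval a * (T ℝ (M - i)).eval a
    = (U ℝ (M - 1)).eval a + (M + 2) * (T ℝ (M + 1)).eval a := by
  have h1 := (hasDerivAt_cheb_vector_field M a).neg
  have hg : HasDerivAt (fun y => (T ℝ (M + 1)).eval y + (T ℝ (M + 1)).eval a
      + 2 * ∑ i ∈ range M, (T ℝ (i + 1)).eval y * (T ℝ (M - i)).eval a)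
      (deriv (fun y => (T ℝ (M + 1)).eval y + (T ℝ (M + 1)).eval a
      + 2 * ∑ i ∈ range M, (T ℝ (i + 1)).eval y * (T ℝ (M - i)).eval a) a) a := by
    apply DifferentiableAt.hasDerivAt
    fun_prop
  have h2 := ((hasDerivAt_id a).sub_const a).mul hg
  simp only [id, sub_self, one_mul, zero_mul, add_zero] at h2
  have h3 := h1.add_const ((1 - a ^ 2) * (U ℝ M).eval a)
  have h4 := h2.unique (h3.congr_of_eventuallyEq (Eventually.of_forall fun y => by
    have := cheb_divided_difference M y a
    simp only [Pi.mul_apply, Pi.neg_apply]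
    rw [this]; ring))
  linarith

open Polynomial.Chebyshev in
theorem cheb_vector_field_mul_U (k p : ℤ) (a : ℝ) :
    (1 - a ^ 2) * (U ℝ (k - 1)).eval a * (U ℝ (p - 1)).eval a
      = ((T ℝ (k - p)).eval a - (T ℝ (k + p)).eval a) / 2 := by
  have hT : ∀ (k : ℤ), (T ℝ (k + 1)).eval a = 2 * a * (T ℝ k).eval a - (T ℝ (k - 1)).eval a := by
    intro k
    have h2 := congrArg (Polynomial.eval a) (T_add_one ℝ k)
    simpa using h2
  have hU : ∀ (k : ℤ), (U ℝ (k + 1)).eval a = 2 * a * (U ℝ k).eval a - (U ℝ (k - 1)).eval a := by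
    intro k
    have h2 := congrArg (Polynomial.eval a) (U_add_one ℝ k)
    simpa using h2
  have main : ∀ p : ℕ, ((1 - a ^ 2) * (U ℝ (k - 1)).eval a * (U ℝ ((p : ℤ) - 1)).eval a
      = ((T ℝ (k - p)).eval a - (T ℝ (k + p)).eval a) / 2) ∧
      ((1 - a ^ 2) * (U ℝ (k - 1)).eval a * (U ℝ (p : ℤ)).eval a
      = ((T ℝ (k - (p + 1))).eval a - (T ℝ (k + (p + 1))).eval a) / 2) := by
    intro p
    induction p with
    | zero =>
      constructor
      · simp
      · simpa using cheb_vector_field_eq k a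
    | succ p ih =>
      obtain ⟨h1, h2⟩ := ih
      refine ⟨by push_cast; simpa using h2, ?_⟩
      push_cast
      have e1 := hU p
      have e2 := hT (k + (p + 1))
      have e3 := hT (k - (p + 1))
      rw [show k + ((p : ℤ) + 1) + 1 = k + (p + 1 + 1) by ring,
        show k + ((p : ℤ) + 1) - 1 = k + p by ring] at e2
      rw [show k - ((p : ℤ) + 1) + 1 = k - p by ring,
        show k - ((p : ℤ) + 1) - 1 = k - (p + 1 + 1) by ring] at e3
      rw [e1, e2]
      linear_combination (2 * a) * h2 - h1 - e3 / 2
  rcases Int.le_total 0 p with h | h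
  · lift p to ℕ using h
    exact (main p).1
  · obtain ⟨q, rfl⟩ : ∃ q : ℕ, p = -q := ⟨p.natAbs, by omega⟩
    have := (main q).1
    rw [U_neg_sub_one]
    simp only [Polynomial.eval_neg, sub_neg_eq_add, ← sub_eq_add_neg]
    linarith

/-- The order-one part of the mean of the `s`-th Chebyshev statistic, multiplied by `β`. -/
noncomputable def ellMean (β α δ : ℝ) (s : ℕ) : ℝ :=
  -α * (-1) ^ s - δ / 2 - (if Even s then 1 - β / 2 else 0)

/-- Chebyshev coefficients of the linear part of the loop equation. -/
noncomputable def ellCoef (β α δ : ℝ) (m j : ℕ) : ℝ :=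
  if j = 0 then ellMean β α δ m
  else if j = m then -((m + 1) * (1 - β / 2) + α + δ / 2)
  else 2 * ellMean β α δ (m - j)

open Polynomial.Chebyshev in
theorem cheb_U_eq_sum (M : ℕ) (a : ℝ) :
    (U ℝ M).eval a = (if Even M then 1 else 0) +
      ∑ i ∈ range M, (if Even (M - (i + 1)) then 2 * (T ℝ (i + 1)).eval a else 0) := by
  induction M using Nat.twoStepInduction with
  | zero => simp
  | one => simp
  | more M ih1 _ =>
    have h := congrArg (Polynomial.eval a) (U_eq_two_mul_T_add_U ℝ M)
    simp only [Polynomial.eval_add, Polynomial.eval_mul, Polynomial.eval_ofNat] at h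
    push_cast
    rw [h, ih1, sum_range_succ, sum_range_succ]
    have : ∀ i ∈ range M, (if Even (M + 1 - i) then 2 * (T ℝ (i + 1)).eval a else 0)
        = (if Even (M - (i + 1)) then 2 * (T ℝ (i + 1)).eval a else 0) := by
      intro i hi
      rw [mem_range] at hi
      rw [show M + 1 - i = M - (i + 1) + 2 by omega]
      simp [Nat.even_add]
    simp only [Nat.reduceSubDiff]
    rw [sum_congr rfl this]
    simp only [Nat.even_add, even_two, iff_true, Nat.add_sub_cancel_left, Nat.not_even_one,
      if_false, Nat.sub_self, Even.zero, if_true, Nat.cast_add, Nat.cast_one]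
    rw [show (M : ℤ) + 1 + 1 = M + 2 by ring]
    ring

open Polynomial.Chebyshev in
theorem cheb_linear_part_eq_sum (β α δ : ℝ) (M : ℕ) (a : ℝ) :
    (α - δ / 2) * (U ℝ M).eval a - (α + δ / 2 + (1 - β / 2)) * (U ℝ (M - 1)).eval a
      - ((M + 2) * (1 - β / 2) + α + δ / 2) * (T ℝ (M + 1)).eval a
    = ellCoef β α δ (M + 1) 0
      + ∑ i ∈ range (M + 1), ellCoef β α δ (M + 1) (i + 1) * (T ℝ (i + 1)).eval a := by
  have hU1 : (U ℝ ((M : ℤ) - 1)).eval a = (if Even M then 0 else 1) +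
      ∑ i ∈ range M, (if Even (M - (i + 1)) then 0 else 2 * (T ℝ (i + 1)).eval a) := by
    cases M with
    | zero => simp
    | succ M =>
      have := cheb_U_eq_sum M a
      push_cast
      rw [show (M : ℤ) + 1 - 1 = M by ring, this, sum_range_succ]
      congr 1
      · simp only [Nat.even_add_one]; split_ifs <;> simp
      · simp only [Nat.sub_self, Even.zero, if_true, add_zero]
        refine sum_congr rfl fun i hi => ?_
        rw [mem_range] at hi
        rw [show M - i = M - (i + 1) + 1 by omega]
        simp only [Nat.even_add_one]; split_ifs <;> simp
  rw [hU1, cheb_U_eq_sum, sum_range_succ]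
  have h2 : ∀ i ∈ range M, ellCoef β α δ (M + 1) (i + 1) * (T ℝ (i + 1)).eval a
      = (α - δ / 2) * (if Even (M - (i + 1)) then 2 * (T ℝ (i + 1)).eval a else 0)
        - (α + δ / 2 + (1 - β / 2)) *
          (if Even (M - (i + 1)) then 0 else 2 * (T ℝ (i + 1)).eval a) := by
    intro i hi
    rw [mem_range] at hi
    have h3 : i + 1 ≠ M + 1 := by omega
    have h4 : M + 1 - (i + 1) = M - (i + 1) + 1 := by omega
    simp only [ellCoef, h3, if_false, Nat.succ_ne_zero, h4, ellMean, Nat.even_add_one, pow_succ]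
    by_cases h5 : Even (M - (i + 1))
    · simp [h5, h5.neg_one_pow]; ring
    · simp [h5, (Nat.not_even_iff_odd.1 h5).neg_one_pow]; ring
  rw [sum_congr rfl h2, sum_sub_distrib, ← mul_sum, ← mul_sum]
  simp only [ellCoef, if_true, Nat.succ_ne_zero, if_false, ellMean, Nat.even_add_one, pow_succ]
  push_cast
  by_cases h5 : Even M
  · simp [h5, h5.neg_one_pow]; ring
  · simp [h5, (Nat.not_even_iff_odd.1 h5).neg_one_pow]; ring

lemma restrict_cube_eq_pi (n : ℕ) :
    (volume : Measure (Fin n → ℝ)).restrict (Set.Icc 0 1)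
      = Measure.pi fun _ => (volume : Measure ℝ).restrict (Set.Icc 0 1) := by
  rw [← Set.pi_univ_Icc, volume_pi, Measure.restrict_pi_pi]
  rfl

lemma integrable_jacobi_weight {α δ : ℝ} (hα : -1 < α) (hδ : -2 < δ) :
    Integrable (fun t : ℝ => t ^ α * (1 - t) ^ (δ / 2)) (volume.restrict (Set.Icc 0 1)) := by
  have h := Complex.betaIntegral_convergent (u := ((α + 1 : ℝ) : ℂ)) (v := ((δ / 2 + 1 : ℝ) : ℂ))
    (by rw [Complex.ofReal_re]; linarith) (by rw [Complex.ofReal_re]; linarith)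
  rw [intervalIntegrable_iff_integrableOn_Ioc_of_le zero_le_one] at h
  change IntegrableOn _ _ _
  rw [integrableOn_Icc_iff_integrableOn_Ioc]
  refine (Integrable.re h).congr ?_
  refine ae_restrict_of_forall_mem measurableSet_Ioc fun x hx => ?_
  have h1 : (x : ℂ) ^ (((α + 1 : ℝ) : ℂ) - 1) = ((x ^ α : ℝ) : ℂ) := by
    rw [Complex.ofReal_cpow hx.1.le]; push_cast; ring_nf
  have h2 : (1 - (x : ℂ)) ^ (((δ / 2 + 1 : ℝ) : ℂ) - 1) = (((1 - x) ^ (δ / 2) : ℝ) : ℂ) := by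
    rw [Complex.ofReal_cpow (by linarith [hx.2])]; push_cast; ring_nf
  simp only [h1, h2, ← Complex.ofReal_mul]
  simp

lemma integrable_prod_jacobi_weight {α δ : ℝ} (hα : -1 < α) (hδ : -2 < δ) (n : ℕ) :
    Integrable (fun T : Fin n → ℝ => ∏ j, T j ^ α * (1 - T j) ^ (δ / 2))
      (volume.restrict (Set.Icc 0 1)) := by
  rw [restrict_cube_eq_pi]
  exact Integrable.fintype_prod (f := fun _ t => t ^ α * (1 - t) ^ (δ / 2))
    fun _ => integrable_jacobi_weight hα hδ

/-- A measurable function bounded on the cube is integrable against the product Jacobi weight. -/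
lemma integrable_mul_prod_jacobi_weight {α δ : ℝ} (hα : -1 < α) (hδ : -2 < δ) {n : ℕ}
    {F : (Fin n → ℝ) → ℝ} (hF : Measurable F) {c : ℝ} (hc : ∀ T ∈ Set.Icc 0 1, |F T| ≤ c) :
    Integrable (fun T : Fin n → ℝ => F T * ∏ j, T j ^ α * (1 - T j) ^ (δ / 2))
      (volume.restrict (Set.Icc 0 1)) :=
  (integrable_prod_jacobi_weight hα hδ n).bdd_mul hF.aestronglyMeasurable
    (ae_restrict_of_forall_mem measurableSet_Icc hc)

lemma vand_eq_prod_sigma (β : ℝ) {n : ℕ} (T : Fin n → ℝ) :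
    vand β T = ∏ p ∈ (univ : Finset (Fin n)).sigma (fun j => Ioi j), |T p.2 - T p.1| ^ β := by
  rw [vand, Finset.prod_sigma']

lemma vand_nonneg (β : ℝ) {n : ℕ} (T : Fin n → ℝ) : 0 ≤ vand β T :=
  Finset.prod_nonneg fun _ _ => Finset.prod_nonneg fun _ _ => Real.rpow_nonneg (abs_nonneg _) _

lemma continuous_vand {β : ℝ} (hβ : 0 ≤ β) {n : ℕ} : Continuous (vand β : (Fin n → ℝ) → ℝ) := by
  unfold vand
  refine continuous_finsetProd _ fun j _ => continuous_finsetProd _ fun k _ => ?_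
  exact Continuous.rpow_const (by fun_prop) fun _ => Or.inr hβ

lemma abs_sub_le_one_of_mem_cube {n : ℕ} {T : Fin n → ℝ} (hT : T ∈ Set.Icc (0 : Fin n → ℝ) 1)
    (j k : Fin n) : |T k - T j| ≤ 1 := by
  have h1 := hT.1 j; have h2 := hT.2 j; have h3 := hT.1 k; have h4 := hT.2 k
  simp only [Pi.zero_apply, Pi.one_apply] at h1 h2 h3 h4
  rw [abs_le]; constructor <;> linarith

lemma vand_le_pair {β : ℝ} (hβ : 0 ≤ β) {n : ℕ} {T : Fin n → ℝ}
    (hT : T ∈ Set.Icc (0 : Fin n → ℝ) 1) {j k : Fin n} (hjk : j < k) :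
    vand β T ≤ |T k - T j| ^ β := by
  have hmem : (⟨j, k⟩ : Σ _ : Fin n, Fin n) ∈ (univ : Finset (Fin n)).sigma (fun j => Ioi j) := by
    simpa using hjk
  rw [vand_eq_prod_sigma, ← Finset.mul_prod_erase _ _ hmem]
  refine mul_le_of_le_one_right (Real.rpow_nonneg (abs_nonneg _) _) ?_
  exact Finset.prod_le_one (fun _ _ => Real.rpow_nonneg (abs_nonneg _) _)
    fun p _ => Real.rpow_le_one (abs_nonneg _) (abs_sub_le_one_of_mem_cube hT _ _) hβ

lemma abs_vand_div_le_one {β : ℝ} (hβ : 1 ≤ β) {n : ℕ} {T : Fin n → ℝ}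
    (hT : T ∈ Set.Icc (0 : Fin n → ℝ) 1) {j k : Fin n} (hjk : j < k) :
    |vand β T / (T k - T j)| ≤ 1 := by
  rw [abs_div, abs_of_nonneg (vand_nonneg _ _)]
  rcases eq_or_lt_of_le (abs_nonneg (T k - T j)) with h0 | h0
  · rw [← h0]; simp
  · rw [div_le_one h0]
    refine (vand_le_pair (zero_le_one.trans hβ) hT hjk).trans ?_
    calc |T k - T j| ^ β ≤ |T k - T j| ^ (1 : ℝ) :=
          Real.rpow_le_rpow_of_exponent_ge h0 (abs_sub_le_one_of_mem_cube hT _ _) hβ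
      _ = _ := Real.rpow_one _

lemma vand_eq_zero {β : ℝ} (hβ : 0 < β) {n : ℕ} {T : Fin n → ℝ} {j k : Fin n} (hjk : j < k)
    (h : T k = T j) : vand β T = 0 := by
  unfold vand
  refine Finset.prod_eq_zero (mem_univ j) (Finset.prod_eq_zero (mem_Ioi.2 hjk) ?_)
  rw [h, sub_self, abs_zero, Real.zero_rpow hβ.ne']

lemma jacW_nonneg (β α δ : ℝ) {n : ℕ} {T : Fin n → ℝ} (hT : T ∈ Set.Icc (0 : Fin n → ℝ) 1) :
    0 ≤ jacW β α δ n T := by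
  refine mul_nonneg (Finset.prod_nonneg fun j _ => ?_) (vand_nonneg _ _)
  have h2 := hT.2 j
  simp only [Pi.one_apply] at h2
  exact mul_nonneg (Real.rpow_nonneg (hT.1 j) _) (Real.rpow_nonneg (by linarith) _)

lemma exists_bound_on_cube {n : ℕ} {F : (Fin n → ℝ) → ℝ} (hF : Continuous F) :
    ∃ c, ∀ T ∈ Set.Icc (0 : Fin n → ℝ) 1, |F T| ≤ c :=
  isCompact_Icc.exists_bound_of_continuousOn hF.continuousOn

lemma integrable_mul_jacW {β α δ : ℝ} (hβ : 0 ≤ β) (hα : -1 < α) (hδ : -2 < δ) {n : ℕ}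
    {F : (Fin n → ℝ) → ℝ} (hF : Continuous F) :
    Integrable (fun T => F T * jacW β α δ n T) (volume.restrict (Set.Icc (0 : Fin n → ℝ) 1)) := by
  have hc := hF.mul (continuous_vand (n := n) hβ)
  obtain ⟨c, hc'⟩ := exists_bound_on_cube hc
  refine (integrable_mul_prod_jacobi_weight hα hδ hc.measurable hc').congr (.of_forall fun T => ?_)
  simp only [jacW, Pi.mul_apply]; ring

lemma integrable_mul_jacW_div {β α δ : ℝ} (hβ : 1 ≤ β) (hα : -1 < α) (hδ : -2 < δ) {n : ℕ}
    {F : (Fin n → ℝ) → ℝ} (hF : Continuous F) {j k : Fin n} (hjk : j < k) :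
    Integrable (fun T => F T * (jacW β α δ n T / (T k - T j)))
      (volume.restrict (Set.Icc (0 : Fin n → ℝ) 1)) := by
  obtain ⟨c, hc⟩ := exists_bound_on_cube hF
  have hm : Measurable fun T : Fin n → ℝ => F T * (vand β T / (T k - T j)) := by
    refine hF.measurable.mul ((continuous_vand (zero_le_one.trans hβ)).measurable.div ?_)
    fun_prop
  refine (integrable_mul_prod_jacobi_weight hα hδ hm (c := c) fun T hT => ?_).congr
    (.of_forall fun T => ?_)
  · rw [abs_mul]
    exact (mul_le_of_le_one_right (abs_nonneg _) (abs_vand_div_le_one hβ hT hjk)).trans (hc T hT)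
  · simp only [jacW]; ring

/-- Positivity of integrals of positive continuous functions against the Jacobi weight. -/
lemma integral_mul_jacW_pos {β α δ : ℝ} (hβ : 0 ≤ β) (hα : -1 < α) (hδ : -2 < δ) {n : ℕ}
    {F : (Fin n → ℝ) → ℝ} (hF : Continuous F) (hpos : ∀ T, 0 < F T) :
    0 < ∫ T in Set.Icc (0 : Fin n → ℝ) 1, F T * jacW β α δ n T := by
  rw [setIntegral_pos_iff_support_of_nonneg_ae
    (ae_restrict_of_forall_mem measurableSet_Icc fun T hT =>
      mul_nonneg (hpos T).le (jacW_nonneg β α δ hT))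
    (integrable_mul_jacW hβ hα hδ hF)]
  set U : Set (Fin n → ℝ) := {T | (∀ j, 0 < T j) ∧ (∀ j, T j < 1) ∧ ∀ j k, j < k → T j < T k}
  have hU : IsOpen U := by
    have : U = (⋂ j, {T | 0 < T j}) ∩ ((⋂ j, {T | T j < 1}) ∩
        ⋂ j, ⋂ k, ⋂ _ : j < k, {T | T j < T k}) := by
      ext T; simp [U]
    rw [this]
    refine (isOpen_iInter_of_finite fun j => isOpen_lt (by fun_prop) (by fun_prop)).inter
      ((isOpen_iInter_of_finite fun j => isOpen_lt (by fun_prop) (by fun_prop)).inter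
      (isOpen_iInter_of_finite fun j => isOpen_iInter_of_finite fun k =>
        isOpen_iInter_of_finite fun _ => isOpen_lt (by fun_prop) (by fun_prop)))
  have hne : U.Nonempty := by
    refine ⟨fun j => ((j : ℕ) + 1 : ℝ) / (n + 1), fun j => by positivity, fun j => ?_,
      fun j k hjk => ?_⟩
    · rw [div_lt_one (by positivity)]
      have : ((j : ℕ) : ℝ) < n := by exact_mod_cast j.2
      linarith
    · have : ((j : ℕ) : ℝ) < (k : ℕ) := by exact_mod_cast hjk
      have h0 : (0 : ℝ) < n + 1 := by positivity
      exact div_lt_div_of_pos_right (by linarith) h0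
  refine (hU.measure_pos volume hne).trans_le (measure_mono fun T hT => ⟨?_, ?_, ?_⟩)
  · have h1 : 0 < ∏ j, T j ^ α * (1 - T j) ^ (δ / 2) := Finset.prod_pos fun j _ =>
      mul_pos (Real.rpow_pos_of_pos (hT.1 j) _)
        (Real.rpow_pos_of_pos (sub_pos.2 (hT.2.1 j)) _)
    have h2 : 0 < vand β T := Finset.prod_pos fun j _ => Finset.prod_pos fun k hk =>
      Real.rpow_pos_of_pos (abs_pos.2 (sub_ne_zero.2 (hT.2.2 j k (mem_Ioi.1 hk)).ne')) _
    exact (mul_pos (hpos T) (mul_pos h1 h2)).ne'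
  · exact fun j => (hT.1 j).le
  · exact fun j => (hT.2.1 j).le

lemma integral_jacobi_deriv_eq_zero {α δ : ℝ} (hα : -1 < α) (hδ : -2 < δ) {A A' : ℝ → ℝ}
    {s : Set ℝ} (hs : s.Countable) (hA : Continuous A) (hd : ∀ t, t ∉ s → HasDerivAt A (A' t) t)
    (hInt : Integrable (fun t : ℝ => t ^ α * (1 - t) ^ (δ / 2) *
      (t * (1 - t) * A' t + ((α + 1) * (1 - t) - (δ / 2 + 1) * t) * A t))
      (volume.restrict (Set.Icc 0 1))) :
    ∫ t in Set.Icc (0 : ℝ) 1, t ^ α * (1 - t) ^ (δ / 2) *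
      (t * (1 - t) * A' t + ((α + 1) * (1 - t) - (δ / 2 + 1) * t) * A t) = 0 := by
  have hii : IntervalIntegrable (fun t : ℝ => t ^ α * (1 - t) ^ (δ / 2) *
      (t * (1 - t) * A' t + ((α + 1) * (1 - t) - (δ / 2 + 1) * t) * A t)) volume 0 1 := by
    rw [intervalIntegrable_iff_integrableOn_Ioc_of_le zero_le_one,
      ← integrableOn_Icc_iff_integrableOn_Ioc]
    exact hInt
  have h := integral_eq_of_hasDerivAt_off_countable_of_le
    (fun t : ℝ => t ^ (α + 1) * (1 - t) ^ (δ / 2 + 1) * A t) _ zero_le_one hs ?_ ?_ hii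
  · rw [integral_Icc_eq_integral_Ioc, ← intervalIntegral.integral_of_le zero_le_one, h]
    simp only [sub_self]
    rw [Real.zero_rpow (by linarith), Real.zero_rpow (by linarith)]
    ring
  · refine Continuous.continuousOn ?_
    have h1 : Continuous fun t : ℝ => t ^ (α + 1) :=
      Continuous.rpow_const continuous_id fun _ => Or.inr (by linarith)
    have h2 : Continuous fun t : ℝ => (1 - t) ^ (δ / 2 + 1) :=
      Continuous.rpow_const (by fun_prop) fun _ => Or.inr (by linarith)
    exact (h1.mul h2).mul hA
  · rintro t ⟨⟨ht0, ht1⟩, hts⟩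
    have ht1' : 0 < 1 - t := sub_pos.2 ht1
    have h1 : HasDerivAt (fun t : ℝ => t ^ (α + 1)) ((α + 1) * t ^ α) t := by
      refine (Real.hasDerivAt_rpow_const (p := α + 1) (Or.inl ht0.ne')).congr_deriv ?_
      rw [add_sub_cancel_right]
    have h2 : HasDerivAt (fun t : ℝ => (1 - t) ^ (δ / 2 + 1))
        (-((δ / 2 + 1) * (1 - t) ^ (δ / 2))) t := by
      refine (((hasDerivAt_id t).const_sub 1).rpow_const (p := δ / 2 + 1)
        (Or.inl ht1'.ne')).congr_deriv ?_
      rw [add_sub_cancel_right]; simp only [id]; ring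
    refine ((h1.mul h2).mul (hd t hts)).congr_deriv ?_
    simp only [Pi.mul_apply]
    rw [Real.rpow_add_one ht0.ne', Real.rpow_add_one ht1'.ne']
    ring

lemma integral_cube_jacobi_deriv_eq_zero {α δ : ℝ} (hα : -1 < α) (hδ : -2 < δ) {n : ℕ}
    (i : Fin (n + 1)) {A A' : (Fin (n + 1) → ℝ) → ℝ} (hA : Continuous A)
    (hd : ∀ (S : Fin n → ℝ) (t : ℝ), t ∉ Set.range S →
      HasDerivAt (fun t => A (i.insertNth t S)) (A' (i.insertNth t S)) t)
    (hInt : Integrable (fun T : Fin (n + 1) → ℝ => (∏ j, T j ^ α * (1 - T j) ^ (δ / 2)) *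
      (T i * (1 - T i) * A' T + ((α + 1) * (1 - T i) - (δ / 2 + 1) * T i) * A T))
      (volume.restrict (Set.Icc 0 1))) :
    ∫ T in Set.Icc (0 : Fin (n + 1) → ℝ) 1, (∏ j, T j ^ α * (1 - T j) ^ (δ / 2)) *
      (T i * (1 - T i) * A' T + ((α + 1) * (1 - T i) - (δ / 2 + 1) * T i) * A T) = 0 := by
  rw [restrict_cube_eq_pi] at hInt ⊢
  have hmp := (measurePreserving_piFinSuccAbove
    (fun _ : Fin (n + 1) => (volume : Measure ℝ).restrict (Set.Icc 0 1)) i).symm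
  rw [← hmp.integral_comp']
  rw [← hmp.integrable_comp_emb (MeasurableEquiv.measurableEmbedding _)] at hInt
  refine (integral_prod_symm _ hInt).trans ?_
  refine integral_eq_zero_of_ae ?_
  filter_upwards [hInt.prod_left_ae] with S hS
  have key : ∀ t : ℝ, ∏ j, (i.insertNth t S : Fin (n + 1) → ℝ) j ^ α *
      (1 - (i.insertNth t S : Fin (n + 1) → ℝ) j) ^ (δ / 2) =
      (∏ j, S j ^ α * (1 - S j) ^ (δ / 2)) * (t ^ α * (1 - t) ^ (δ / 2)) := by
    intro t
    rw [Fin.prod_univ_succAbove _ i]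
    simp only [Fin.insertNth_apply_same, Fin.insertNth_apply_succAbove]
    ring
  simp only [MeasurableEquiv.piFinSuccAbove_symm_apply, Fin.insertNthEquiv_apply,
    Fin.insertNth_apply_same, Function.comp_def, key, mul_assoc, Pi.zero_apply] at hS ⊢
  rw [integral_const_mul]
  rcases eq_or_ne (∏ j, S j ^ α * (1 - S j) ^ (δ / 2)) 0 with h0 | h0
  · rw [h0, zero_mul]
  · rw [integrable_const_mul_iff (isUnit_iff_ne_zero.2 h0)] at hS
    have := integral_jacobi_deriv_eq_zero hα hδ (A := fun t => A (i.insertNth t S))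
      (A' := fun t => A' (i.insertNth t S)) (Set.countable_range S) ?_ (hd S) ?_
    · simp only [mul_assoc] at this
      exact (congrArg _ this).trans (mul_zero _)
    · exact hA.comp (by fun_prop)
    · simp only [mul_assoc]
      exact hS

lemma HasDerivAt.prod_of_logDeriv {ι : Type*} (s : Finset ι) {f : ι → ℝ → ℝ} {g : ι → ℝ} {x : ℝ}
    (h : ∀ i ∈ s, HasDerivAt (f i) (f i x * g i) x) :
    HasDerivAt (fun y => ∏ i ∈ s, f i y) ((∏ i ∈ s, f i x) * ∑ i ∈ s, g i) x := by
  classical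
  refine (HasDerivAt.fun_finsetProd h).congr_deriv ?_
  rw [Finset.mul_sum]
  refine Finset.sum_congr rfl fun i hi => ?_
  rw [smul_eq_mul, ← mul_assoc, Finset.prod_erase_mul _ _ hi]

lemma hasDerivAt_abs_rpow_of_ne_zero (β : ℝ) {x : ℝ} (hx : x ≠ 0) :
    HasDerivAt (fun y : ℝ => |y| ^ β) (|x| ^ β * (β / x)) x := by
  refine ((hasDerivAt_abs hx).rpow_const (p := β) (Or.inl (abs_ne_zero.2 hx))).congr_deriv ?_
  rw [Real.rpow_sub_one (abs_ne_zero.2 hx)]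
  rcases hx.lt_or_gt with h | h
  · rw [abs_of_neg h, sign_neg h]; simp; field_simp
  · rw [abs_of_pos h, sign_pos h]; simp; field_simp

/-- The logarithmic derivative of the Vandermonde factor in the `i`-th variable. -/
noncomputable def vandLogDeriv (β : ℝ) {n : ℕ} (i : Fin n) (T : Fin n → ℝ) : ℝ :=
  ∑ j, ∑ k ∈ Ioi j, β * ((if k = i then 1 else 0) - if j = i then 1 else 0) / (T k - T j)

lemma hasDerivAt_vand (β : ℝ) {n : ℕ} (i : Fin (n + 1)) (S : Fin n → ℝ) {t : ℝ}
    (ht : t ∉ Set.range S) :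
    HasDerivAt (fun t => vand β (i.insertNth t S : Fin (n + 1) → ℝ))
      (vand β (i.insertNth t S : Fin (n + 1) → ℝ) *
        vandLogDeriv β i (i.insertNth t S : Fin (n + 1) → ℝ)) t := by
  unfold vandLogDeriv
  rw [Finset.sum_sigma']
  simp only [vand_eq_prod_sigma]
  refine HasDerivAt.prod_of_logDeriv _ ?_
  rintro ⟨j, k⟩ hjk
  have hjk' : j < k := by simpa using hjk
  have hc : ∀ m : Fin n, t - S m ≠ 0 := fun m h => ht ⟨m, (sub_eq_zero.1 h).symm⟩
  rcases eq_or_ne k i with rfl | hk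
  · obtain ⟨j', rfl⟩ := Fin.exists_succAbove_eq hjk'.ne
    simp only [Fin.insertNth_apply_same, Fin.insertNth_apply_succAbove, if_true,
      if_neg hjk'.ne, sub_zero, mul_one]
    have := (hasDerivAt_abs_rpow_of_ne_zero β (hc j')).comp t ((hasDerivAt_id t).sub_const (S j'))
    simpa [Function.comp_def] using this
  · obtain ⟨k', rfl⟩ := Fin.exists_succAbove_eq hk
    rcases eq_or_ne j i with rfl | hj
    · simp only [Fin.insertNth_apply_same, Fin.insertNth_apply_succAbove, if_true,
        if_neg hjk'.ne', zero_sub, mul_neg, mul_one]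
      have := (hasDerivAt_abs_rpow_of_ne_zero β (x := S k' - t) (by rw [← neg_sub]; exact neg_ne_zero.2 (hc k'))).comp t
        ((hasDerivAt_id t).const_sub (S k'))
      refine this.congr_deriv ?_
      ring
    · obtain ⟨j', rfl⟩ := Fin.exists_succAbove_eq hj
      simp only [Fin.insertNth_apply_succAbove, if_neg hk, if_neg hj, sub_zero, mul_zero, zero_div]
      exact hasDerivAt_const _ _

/-- The Chebyshev linear statistic `∑ i, T_j(2 T_i - 1)`. -/
noncomputable def chebStat {n : ℕ} (j : ℕ) (T : Fin n → ℝ) : ℝ :=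
  ∑ i, (Polynomial.Chebyshev.T ℝ j).eval (2 * T i - 1)

@[fun_prop]
lemma continuous_chebStat {n : ℕ} (j : ℕ) : Continuous (chebStat j : (Fin n → ℝ) → ℝ) := by
  unfold chebStat
  fun_prop

/-- The divided difference kernel of the Chebyshev vector field. -/
noncomputable def chebKernel (M : ℕ) (a b : ℝ) : ℝ :=
  (Polynomial.Chebyshev.T ℝ (M + 1)).eval a + (Polynomial.Chebyshev.T ℝ (M + 1)).eval b +
    2 * ∑ i ∈ range M, (Polynomial.Chebyshev.T ℝ (i + 1)).eval a *
      (Polynomial.Chebyshev.T ℝ (M - i)).eval b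

lemma chebKernel_symm (M : ℕ) (a b : ℝ) : chebKernel M a b = chebKernel M b a := by
  unfold chebKernel
  rw [← Finset.sum_range_reflect]
  congr 1
  · ring
  · congr 1
    refine Finset.sum_congr rfl fun i hi => ?_
    have hi' := Finset.mem_range.1 hi
    have h : ((M - 1 - i : ℕ) : ℤ) = M - 1 - i := by omega
    rw [h, mul_comm]
    ring_nf

lemma sum_sum_chebKernel {n : ℕ} (M : ℕ) (T : Fin n → ℝ) :
    ∑ j, ∑ k, chebKernel M (2 * T k - 1) (2 * T j - 1) =
      2 * (n * chebStat (M + 1) T + ∑ i ∈ range M, chebStat (i + 1) T * chebStat (M - i) T) := by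
  simp only [chebKernel, Finset.sum_add_distrib, Finset.sum_const, Finset.card_univ,
    Fintype.card_fin, nsmul_eq_mul, ← Finset.mul_sum]
  have h1 : ∑ j : Fin n, ∑ k : Fin n, ∑ i ∈ range M,
      (Polynomial.Chebyshev.T ℝ (i + 1)).eval (2 * T k - 1) *
      (Polynomial.Chebyshev.T ℝ (M - i)).eval (2 * T j - 1) =
      ∑ i ∈ range M, chebStat (i + 1) T * chebStat (M - i) T := by
    calc _ = ∑ j : Fin n, ∑ i ∈ range M, ∑ k : Fin n,
          (Polynomial.Chebyshev.T ℝ (i + 1)).eval (2 * T k - 1) *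
          (Polynomial.Chebyshev.T ℝ (M - i)).eval (2 * T j - 1) :=
        Finset.sum_congr rfl fun j _ => Finset.sum_comm
      _ = _ := by
        rw [Finset.sum_comm]
        refine Finset.sum_congr rfl fun i hi => ?_
        have h : ((M - i : ℕ) : ℤ) = M - i := by have := Finset.mem_range.1 hi; omega
        simp only [chebStat, h, Finset.sum_mul_sum]
        rw [Finset.sum_comm]
        push_cast
        rfl
  rw [h1]
  simp only [chebStat]
  push_cast
  ring

lemma two_mul_sum_Ioi_chebKernel {n : ℕ} (M : ℕ) (T : Fin n → ℝ) :
    2 * ∑ j, ∑ k ∈ Ioi j, chebKernel M (2 * T k - 1) (2 * T j - 1) =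
      2 * (n * chebStat (M + 1) T + ∑ i ∈ range M, chebStat (i + 1) T * chebStat (M - i) T)
      - ∑ i, ((Polynomial.Chebyshev.U ℝ (M - 1)).eval (2 * T i - 1) +
          (M + 2) * (Polynomial.Chebyshev.T ℝ (M + 1)).eval (2 * T i - 1)) := by
  have h := Finset.sum_sum_Ioi_add_eq_sum_sum_off_diag
    (fun j k : Fin n => chebKernel M (2 * T j - 1) (2 * T k - 1))
  have h2 : ∀ j k : Fin n, chebKernel M (2 * T k - 1) (2 * T j - 1) +
      chebKernel M (2 * T j - 1) (2 * T k - 1) =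
      2 * chebKernel M (2 * T k - 1) (2 * T j - 1) := fun j k => by
    rw [chebKernel_symm M (2 * T j - 1)]; ring
  simp only [h2, ← Finset.mul_sum] at h
  rw [h, ← sum_sum_chebKernel, ← Finset.sum_sub_distrib]
  refine Finset.sum_congr rfl fun j _ => ?_
  rw [← cheb_divided_difference_diag, ← Finset.sum_compl_add_sum {j}, Finset.sum_singleton,
    chebKernel]
  ring

lemma cheb_vector_field_derivative (M : ℕ) (y : ℝ) :
    (1 - y ^ 2) * (Polynomial.Chebyshev.U ℝ M).derivative.eval y =
      2 * y * (Polynomial.Chebyshev.U ℝ M).eval y -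
        ((Polynomial.Chebyshev.U ℝ (M - 1)).eval y +
          (M + 2) * (Polynomial.Chebyshev.T ℝ (M + 1)).eval y) := by
  have h1 : HasDerivAt (fun y : ℝ => 1 - y ^ 2) (-(2 * y)) y := by
    simpa using (hasDerivAt_pow 2 y).const_sub 1
  have h := (h1.mul ((Polynomial.Chebyshev.U ℝ M).hasDerivAt y)).unique
    (hasDerivAt_cheb_vector_field M y)
  linarith

lemma vandLogDeriv_weighted_sum (β : ℝ) {n : ℕ} (v : Fin n → ℝ) (T : Fin n → ℝ) :
    ∑ i, v i * vandLogDeriv β i T = ∑ j, ∑ k ∈ Ioi j, β * ((v k - v j) / (T k - T j)) := by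
  simp only [vandLogDeriv, Finset.mul_sum]
  rw [Finset.sum_comm]
  refine Finset.sum_congr rfl fun j _ => ?_
  rw [Finset.sum_comm]
  refine Finset.sum_congr rfl fun k _ => ?_
  have : ∀ i, v i * (β * ((if k = i then 1 else 0) - if j = i then 1 else 0) / (T k - T j)) =
      (β / (T k - T j)) * ((if k = i then v i else 0) - if j = i then v i else 0) := by
    intro i
    split_ifs <;> ring
  simp only [this]
  rw [← Finset.mul_sum, Finset.sum_sub_distrib]
  simp only [Finset.sum_ite_eq, Finset.mem_univ, if_true]
  ring

/-- The `i`-th integrand of the loop equation. -/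
noncomputable def loopTerm (β α δ : ℝ) {n : ℕ} (M : ℕ) (F : (Fin n → ℝ) → ℝ)
    (F' : Fin n → (Fin n → ℝ) → ℝ) (i : Fin n) (T : Fin n → ℝ) : ℝ :=
  (T i * (1 - T i) * (Polynomial.Chebyshev.U ℝ M).eval (2 * T i - 1) * F' i T +
    F T * (T i * (1 - T i) * (2 * (Polynomial.Chebyshev.U ℝ M).derivative.eval (2 * T i - 1)) +
      ((α + 1) * (1 - T i) - (δ / 2 + 1) * T i) *
        (Polynomial.Chebyshev.U ℝ M).eval (2 * T i - 1))) * jacW β α δ n T +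
    F T * (T i * (1 - T i) * (Polynomial.Chebyshev.U ℝ M).eval (2 * T i - 1)) *
      (jacW β α δ n T * vandLogDeriv β i T)

lemma integrable_mul_jacW_vandLogDeriv {β α δ : ℝ} (hβ : 1 ≤ β) (hα : -1 < α) (hδ : -2 < δ)
    {n : ℕ} {F : (Fin n → ℝ) → ℝ} (hF : Continuous F) (i : Fin n) :
    Integrable (fun T => F T * (jacW β α δ n T * vandLogDeriv β i T))
      (volume.restrict (Set.Icc (0 : Fin n → ℝ) 1)) := by
  simp only [vandLogDeriv, Finset.mul_sum]
  refine integrable_finsetSum _ fun j _ => integrable_finsetSum _ fun k hk => ?_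
  refine ((integrable_mul_jacW_div hβ hα hδ hF (mem_Ioi.1 hk)).const_mul
    (β * ((if k = i then 1 else 0) - if j = i then 1 else 0))).congr (.of_forall fun T => ?_)
  simp only
  ring

lemma integrable_loopTerm {β α δ : ℝ} (hβ : 1 ≤ β) (hα : -1 < α) (hδ : -2 < δ) {n : ℕ} (M : ℕ)
    {F : (Fin n → ℝ) → ℝ} {F' : Fin n → (Fin n → ℝ) → ℝ} (hF : Continuous F)
    (hF' : ∀ i, Continuous (F' i)) (i : Fin n) :
    Integrable (loopTerm β α δ M F F' i) (volume.restrict (Set.Icc (0 : Fin n → ℝ) 1)) := by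
  have := hF' i
  unfold loopTerm
  refine Integrable.add (integrable_mul_jacW (by linarith) hα hδ ?_)
    (integrable_mul_jacW_vandLogDeriv hβ hα hδ ?_ i)
  · fun_prop
  · fun_prop

lemma integral_loopTerm {β α δ : ℝ} (hβ : 1 ≤ β) (hα : -1 < α) (hδ : -2 < δ) {n : ℕ} (M : ℕ)
    {F : (Fin n → ℝ) → ℝ} {F' : Fin n → (Fin n → ℝ) → ℝ} (hF : Continuous F)
    (hF' : ∀ i, Continuous (F' i))
    (hd : ∀ i T t, HasDerivAt (fun t => F (Function.update T i t)) (F' i (Function.update T i t)) t)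
    (i : Fin n) :
    ∫ T in Set.Icc (0 : Fin n → ℝ) 1, loopTerm β α δ M F F' i T = 0 := by
  obtain _ | n := n
  · exact i.elim0
  have hInt := integrable_loopTerm hβ hα hδ M hF hF' i
  set u : ℝ → ℝ := fun x => (Polynomial.Chebyshev.U ℝ M).eval (2 * x - 1) with hu
  set u' : ℝ → ℝ := fun x => 2 * (Polynomial.Chebyshev.U ℝ M).derivative.eval (2 * x - 1) with hu'
  have hud : ∀ x, HasDerivAt u (u' x) x := fun x => by
    have h1 : HasDerivAt (fun x : ℝ => 2 * x - 1) 2 x := by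
      simpa using ((hasDerivAt_id x).const_mul 2).sub_const 1
    have := ((Polynomial.Chebyshev.U ℝ M).hasDerivAt (2 * x - 1)).comp x h1
    refine this.congr_deriv ?_
    rw [mul_comm]
  have huc : Continuous u := by fun_prop
  have heq : ∀ T, (∏ j, T j ^ α * (1 - T j) ^ (δ / 2)) *
      (T i * (1 - T i) * ((F' i T * u (T i) + F T * u' (T i)) * vand β T +
          F T * u (T i) * (vand β T * vandLogDeriv β i T)) +
        ((α + 1) * (1 - T i) - (δ / 2 + 1) * T i) * (F T * u (T i) * vand β T)) =
      loopTerm β α δ M F F' i T := by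
    intro T
    simp only [loopTerm, jacW, hu, hu']
    ring
  have hInt' := hInt.congr (.of_forall fun T => (heq T).symm)
  simp only [← heq]
  refine integral_cube_jacobi_deriv_eq_zero hα hδ i (A := fun T => F T * u (T i) * vand β T)
    (A' := fun T => (F' i T * u (T i) + F T * u' (T i)) * vand β T +
          F T * u (T i) * (vand β T * vandLogDeriv β i T))
    ((hF.mul (huc.comp (continuous_apply i))).mul (continuous_vand (by linarith))) ?_ hInt'
  intro S t ht
  have h1 := hd i (i.insertNth 0 S) t
  simp only [Fin.update_insertNth] at h1
  simp only [Fin.insertNth_apply_same]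
  exact (h1.mul (hud t)).mul (hasDerivAt_vand β i S ht)

lemma sum_loopTerm {β : ℝ} (hβ : 0 < β) (α δ : ℝ) {n : ℕ} (M : ℕ) (F : (Fin n → ℝ) → ℝ)
    (F' : Fin n → (Fin n → ℝ) → ℝ) (T : Fin n → ℝ) :
    2 * ∑ i, loopTerm β α δ M F F' i T =
      (F T * (-β * (n * chebStat (M + 1) T +
          ∑ i ∈ range M, chebStat (i + 1) T * chebStat (M - i) T) +
        n * ellCoef β α δ (M + 1) 0 +
        ∑ i ∈ range (M + 1), ellCoef β α δ (M + 1) (i + 1) * chebStat (i + 1) T) +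
      ∑ i, (1 - (2 * T i - 1) ^ 2) / 2 * (Polynomial.Chebyshev.U ℝ M).eval (2 * T i - 1) *
        F' i T) * jacW β α δ n T := by
  set v : Fin n → ℝ := fun i => T i * (1 - T i) * (Polynomial.Chebyshev.U ℝ M).eval (2 * T i - 1)
    with hv
  have hpair : jacW β α δ n T * (2 * ∑ i, v i * vandLogDeriv β i T) =
      jacW β α δ n T * (-β * ∑ j, ∑ k ∈ Ioi j, chebKernel M (2 * T k - 1) (2 * T j - 1)) := by
    rw [vandLogDeriv_weighted_sum]
    simp only [Finset.mul_sum]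
    refine Finset.sum_congr rfl fun j _ => Finset.sum_congr rfl fun k hk => ?_
    rcases eq_or_ne (T k) (T j) with h | h
    · rw [jacW, vand_eq_zero hβ (mem_Ioi.1 hk) h]; ring
    · have hne : T k - T j ≠ 0 := sub_ne_zero.2 h
      have := cheb_divided_difference M (2 * T k - 1) (2 * T j - 1)
      have h2 : 2 * ((v k - v j) / (T k - T j)) = -chebKernel M (2 * T k - 1) (2 * T j - 1) := by
        rw [← mul_div_assoc, div_eq_iff hne, hv, chebKernel]
        linear_combination (1 / 2) * this
      linear_combination (jacW β α δ n T * β) * h2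
  have hlin : ∑ i, (2 * (T i * (1 - T i) *
        (2 * (Polynomial.Chebyshev.U ℝ M).derivative.eval (2 * T i - 1)) +
      ((α + 1) * (1 - T i) - (δ / 2 + 1) * T i) *
        (Polynomial.Chebyshev.U ℝ M).eval (2 * T i - 1)) +
      β / 2 * ((Polynomial.Chebyshev.U ℝ (M - 1)).eval (2 * T i - 1) +
          (M + 2) * (Polynomial.Chebyshev.T ℝ (M + 1)).eval (2 * T i - 1))) =
      n * ellCoef β α δ (M + 1) 0 +
        ∑ i ∈ range (M + 1), ellCoef β α δ (M + 1) (i + 1) * chebStat (i + 1) T := by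
    have h1 : ∀ i : Fin n, (2 * (T i * (1 - T i) *
        (2 * (Polynomial.Chebyshev.U ℝ M).derivative.eval (2 * T i - 1)) +
      ((α + 1) * (1 - T i) - (δ / 2 + 1) * T i) *
        (Polynomial.Chebyshev.U ℝ M).eval (2 * T i - 1)) +
      β / 2 * ((Polynomial.Chebyshev.U ℝ (M - 1)).eval (2 * T i - 1) +
          (M + 2) * (Polynomial.Chebyshev.T ℝ (M + 1)).eval (2 * T i - 1))) =
        ellCoef β α δ (M + 1) 0 + ∑ j ∈ range (M + 1), ellCoef β α δ (M + 1) (j + 1) *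
          (Polynomial.Chebyshev.T ℝ (j + 1)).eval (2 * T i - 1) := by
      intro i
      rw [← cheb_linear_part_eq_sum]
      have h2 := cheb_vector_field_derivative M (2 * T i - 1)
      have h3 : (2 * T i - 1) * (Polynomial.Chebyshev.U ℝ M).eval (2 * T i - 1) =
          (Polynomial.Chebyshev.T ℝ (M + 1)).eval (2 * T i - 1) +
          (Polynomial.Chebyshev.U ℝ (M - 1)).eval (2 * T i - 1) := by
        have h4 := congrArg (Polynomial.eval (2 * T i - 1))
          (Polynomial.Chebyshev.U_eq_X_mul_U_add_T ℝ M)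
        have h5 := congrArg (Polynomial.eval (2 * T i - 1)) (Polynomial.Chebyshev.U_sub_one ℝ M)
        simp only [Polynomial.eval_mul, Polynomial.eval_sub, Polynomial.eval_add,
          Polynomial.eval_X, Polynomial.eval_ofNat] at h4 h5
        linear_combination h4 - h5
      linear_combination h2 - (α + δ / 2) * h3
    simp only [h1, Finset.sum_add_distrib, Finset.sum_const, Finset.card_univ, Fintype.card_fin,
      nsmul_eq_mul]
    congr 1
    rw [Finset.sum_comm]
    simp only [chebStat, Finset.mul_sum]
    push_cast
    rfl
  have hker := two_mul_sum_Ioi_chebKernel M T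
  rw [← sub_eq_zero]
  have hexp : 2 * ∑ i, loopTerm β α δ M F F' i T =
      (∑ i, (1 - (2 * T i - 1) ^ 2) / 2 * (Polynomial.Chebyshev.U ℝ M).eval (2 * T i - 1) *
        F' i T) * jacW β α δ n T +
      F T * jacW β α δ n T * ∑ i, 2 * (T i * (1 - T i) *
        (2 * (Polynomial.Chebyshev.U ℝ M).derivative.eval (2 * T i - 1)) +
      ((α + 1) * (1 - T i) - (δ / 2 + 1) * T i) *
        (Polynomial.Chebyshev.U ℝ M).eval (2 * T i - 1)) +
      F T * (jacW β α δ n T * (2 * ∑ i, v i * vandLogDeriv β i T)) := by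
    simp only [Finset.mul_sum, Finset.sum_mul, ← Finset.sum_add_distrib]
    refine Finset.sum_congr rfl fun i _ => ?_
    simp only [loopTerm, hv]
    ring
  rw [hexp, hpair]
  rw [Finset.sum_add_distrib, ← Finset.mul_sum (a := β / 2)] at hlin
  linear_combination (F T * jacW β α δ n T) * hlin - (F T * jacW β α δ n T) * (β / 2) * hker

/-- The integrated loop equation. -/
theorem loop_identity {β α δ : ℝ} (hβ : 1 ≤ β) (hα : -1 < α) (hδ : -2 < δ) {n : ℕ} (M : ℕ)
    {F : (Fin n → ℝ) → ℝ} {F' : Fin n → (Fin n → ℝ) → ℝ} (hF : Continuous F)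
    (hF' : ∀ i, Continuous (F' i))
    (hd : ∀ i T t,
      HasDerivAt (fun t => F (Function.update T i t)) (F' i (Function.update T i t)) t) :
    ∫ T in Set.Icc (0 : Fin n → ℝ) 1,
      (F T * (-β * (n * chebStat (M + 1) T +
          ∑ i ∈ range M, chebStat (i + 1) T * chebStat (M - i) T) +
        n * ellCoef β α δ (M + 1) 0 +
        ∑ i ∈ range (M + 1), ellCoef β α δ (M + 1) (i + 1) * chebStat (i + 1) T) +
      ∑ i, (1 - (2 * T i - 1) ^ 2) / 2 * (Polynomial.Chebyshev.U ℝ M).eval (2 * T i - 1) *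
        F' i T) * jacW β α δ n T = 0 := by
  simp only [← sum_loopTerm (zero_lt_one.trans_le hβ)]
  rw [integral_const_mul, integral_finsetSum _ fun i _ => integrable_loopTerm hβ hα hδ M hF hF' i]
  simp only [integral_loopTerm hβ hα hδ M hF hF' hd, Finset.sum_const_zero, mul_zero]

/-- The exponential tilt by conductance and shot noise. -/
noncomputable def tilt {n : ℕ} (z w : ℝ) (T : Fin n → ℝ) : ℝ :=
  Real.exp (∑ j, (-(z * T j) - w * T j * (1 - T j)))

/-- The unnormalised tilted average. -/
noncomputable def tiltInt (β α δ : ℝ) {n : ℕ} (F : (Fin n → ℝ) → ℝ) (z w : ℝ) : ℝ :=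
  ∫ T in Set.Icc (0 : Fin n → ℝ) 1, F T * tilt z w T * jacW β α δ n T

@[fun_prop]
lemma continuous_tilt {n : ℕ} (z w : ℝ) : Continuous (tilt z w : (Fin n → ℝ) → ℝ) := by
  unfold tilt; fun_prop

lemma tilt_pos {n : ℕ} (z w : ℝ) (T : Fin n → ℝ) : 0 < tilt z w T := Real.exp_pos _

lemma tilt_eq {n : ℕ} (z w : ℝ) (T : Fin n → ℝ) :
    tilt z w T = Real.exp (-(z * ∑ j, T j) - w * ∑ j, T j * (1 - T j)) := by
  unfold tilt
  rw [Finset.sum_sub_distrib, Finset.sum_neg_distrib, Finset.mul_sum, Finset.mul_sum]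
  simp only [mul_assoc]

lemma hasFDerivAt_exp_linear (G P : ℝ) (p : ℝ × ℝ) :
    HasFDerivAt (fun p : ℝ × ℝ => Real.exp (-(p.1 * G) - p.2 * P))
      (Real.exp (-(p.1 * G) - p.2 * P) • ((-G) • ContinuousLinearMap.fst ℝ ℝ ℝ -
        P • ContinuousLinearMap.snd ℝ ℝ ℝ)) p := by
  refine HasFDerivAt.exp ?_
  have h1 : HasFDerivAt (fun p : ℝ × ℝ => p.1) (ContinuousLinearMap.fst ℝ ℝ ℝ) p := hasFDerivAt_fst
  have h2 : HasFDerivAt (fun p : ℝ × ℝ => p.2) (ContinuousLinearMap.snd ℝ ℝ ℝ) p := hasFDerivAt_snd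
  refine ((h1.mul_const G).neg.sub (h2.mul_const P)).congr_fderiv ?_
  ext <;> simp

/-- Differentiation of a two-parameter exponential integral with bounded exponents. -/
lemma hasFDerivAt_integral_mul_exp_linear {X : Type*} [MeasurableSpace X] {μ : Measure X}
    {h G P : X → ℝ} (hh : Integrable h μ) (hG : AEStronglyMeasurable G μ)
    (hP : AEStronglyMeasurable P μ) {c : ℝ} (hGc : ∀ᵐ x ∂μ, |G x| ≤ c) (hPc : ∀ᵐ x ∂μ, |P x| ≤ c)
    (p : ℝ × ℝ) :
    HasFDerivAt (fun p : ℝ × ℝ => ∫ x, h x * Real.exp (-(p.1 * G x) - p.2 * P x) ∂μ)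
      (-(∫ x, G x * h x * Real.exp (-(p.1 * G x) - p.2 * P x) ∂μ) •
          ContinuousLinearMap.fst ℝ ℝ ℝ -
        (∫ x, P x * h x * Real.exp (-(p.1 * G x) - p.2 * P x) ∂μ) •
          ContinuousLinearMap.snd ℝ ℝ ℝ) p := by
  have hexpm : ∀ q : ℝ × ℝ, AEStronglyMeasurable
      (fun x => Real.exp (-(q.1 * G x) - q.2 * P x)) μ := fun q =>
    Real.continuous_exp.comp_aestronglyMeasurable ((hG.const_mul q.1).neg.sub (hP.const_mul q.2))
  have hexpb : ∀ C : ℝ, ∀ᵐ x ∂μ, ∀ q : ℝ × ℝ, |q.1| ≤ C → |q.2| ≤ C →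
      Real.exp (-(q.1 * G x) - q.2 * P x) ≤ Real.exp (C * c + C * c) := by
    intro C
    filter_upwards [hGc, hPc] with x hx1 hx2 q hq1 hq2
    refine Real.exp_le_exp.2 ?_
    have e1 : |q.1 * G x| ≤ C * c := by
      rw [abs_mul]; exact mul_le_mul hq1 hx1 (abs_nonneg _) ((abs_nonneg _).trans hq1)
    have e2 : |q.2 * P x| ≤ C * c := by
      rw [abs_mul]; exact mul_le_mul hq2 hx2 (abs_nonneg _) ((abs_nonneg _).trans hq2)
    have := (abs_le.1 e1).1
    have := (abs_le.1 e2).1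
    linarith
  have hInt : ∀ (g : X → ℝ), Integrable g μ → ∀ q : ℝ × ℝ,
      Integrable (fun x => g x * Real.exp (-(q.1 * G x) - q.2 * P x)) μ := by
    intro g hg q
    refine ((hg.bdd_mul (hexpm q) (c := Real.exp (max |q.1| |q.2| * c + max |q.1| |q.2| * c))
      ?_)).congr (.of_forall fun x => mul_comm _ _)
    filter_upwards [hexpb (max |q.1| |q.2|)] with x hx
    rw [Real.norm_of_nonneg (Real.exp_pos _).le]
    exact hx q (le_max_left _ _) (le_max_right _ _)
  have hGh : Integrable (fun x => G x * h x) μ := hh.bdd_mul hG hGc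
  have hPh : Integrable (fun x => P x * h x) μ := hh.bdd_mul hP hPc
  set C : ℝ := max |p.1| |p.2| + 1
  have key := hasFDerivAt_integral_of_dominated_of_fderiv_le (𝕜 := ℝ) (μ := μ)
    (F := fun p x => h x * Real.exp (-(p.1 * G x) - p.2 * P x))
    (F' := fun p x => h x • (Real.exp (-(p.1 * G x) - p.2 * P x) •
      ((-G x) • ContinuousLinearMap.fst ℝ ℝ ℝ - P x • ContinuousLinearMap.snd ℝ ℝ ℝ)))
    (bound := fun x => |h x| * (Real.exp (C * c + C * c) *
      (c * ‖ContinuousLinearMap.fst ℝ ℝ ℝ‖ + c * ‖ContinuousLinearMap.snd ℝ ℝ ℝ‖)))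
    (Metric.closedBall_mem_nhds p one_pos)
    (.of_forall fun q => (hInt h hh q).aestronglyMeasurable) (hInt h hh p) ?_ ?_
    (hh.abs.mul_const _) ?_
  · refine key.congr_fderiv ?_
    have hexp : (fun x => h x • (Real.exp (-(p.1 * G x) - p.2 * P x) •
        ((-G x) • ContinuousLinearMap.fst ℝ ℝ ℝ - P x • ContinuousLinearMap.snd ℝ ℝ ℝ))) =
        fun x => (-(G x * h x * Real.exp (-(p.1 * G x) - p.2 * P x))) •
          ContinuousLinearMap.fst ℝ ℝ ℝ -
          (P x * h x * Real.exp (-(p.1 * G x) - p.2 * P x)) • ContinuousLinearMap.snd ℝ ℝ ℝ := by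
      funext x
      simp only [smul_sub, smul_smul]
      congr 2 <;> ring
    have i1 : Integrable (fun x => -(G x * h x * Real.exp (-(p.1 * G x) - p.2 * P x))) μ :=
      (hInt _ hGh p).neg
    rw [hexp, integral_sub (i1.smul_const _) ((hInt _ hPh p).smul_const _),
      integral_smul_const, integral_smul_const, integral_neg]
  · exact hh.aestronglyMeasurable.smul ((hexpm p).smul
      ((hG.neg.smul_const _).sub (hP.smul_const _)))
  · filter_upwards [hGc, hPc, hexpb C] with x hx1 hx2 hx3 q hq
    rw [norm_smul, norm_smul, Real.norm_of_nonneg (Real.exp_pos _).le, Real.norm_eq_abs]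
    have hq' : ‖q - p‖ ≤ 1 := by simpa [dist_eq_norm] using hq
    have hq1 : |q.1| ≤ C := by
      have h1 := (norm_fst_le (q - p)).trans hq'
      have h2 := abs_sub_abs_le_abs_sub q.1 p.1
      have h3 : |p.1| ≤ max |p.1| |p.2| := le_max_left _ _
      simp only [Prod.fst_sub, Real.norm_eq_abs] at h1
      linarith
    have hq2 : |q.2| ≤ C := by
      have h1 := (norm_snd_le (q - p)).trans hq'
      have h2 := abs_sub_abs_le_abs_sub q.2 p.2
      have h3 : |p.2| ≤ max |p.1| |p.2| := le_max_right _ _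
      simp only [Prod.snd_sub, Real.norm_eq_abs] at h1
      linarith
    refine mul_le_mul_of_nonneg_left ?_ (abs_nonneg _)
    refine mul_le_mul (hx3 q hq1 hq2) ?_ (norm_nonneg _) (Real.exp_pos _).le
    refine (norm_sub_le _ _).trans ?_
    rw [norm_smul, norm_smul, norm_neg]
    exact add_le_add (mul_le_mul_of_nonneg_right hx1 (norm_nonneg _))
      (mul_le_mul_of_nonneg_right hx2 (norm_nonneg _))
  · exact .of_forall fun x q _ => (hasFDerivAt_exp_linear (G x) (P x) q).const_mul (h x)

section
variable {β α δ : ℝ} {n : ℕ} {F : (Fin n → ℝ) → ℝ}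

lemma integrable_tiltInt (hβ : 0 ≤ β) (hα : -1 < α) (hδ : -2 < δ) (hF : Continuous F) (z w : ℝ) :
    Integrable (fun T => F T * tilt z w T * jacW β α δ n T)
      (volume.restrict (Set.Icc (0 : Fin n → ℝ) 1)) :=
  integrable_mul_jacW hβ hα hδ (by fun_prop)

lemma hasFDerivAt_tiltInt (hβ : 0 ≤ β) (hα : -1 < α) (hδ : -2 < δ) (hF : Continuous F)
    (p : ℝ × ℝ) :
    HasFDerivAt (fun p : ℝ × ℝ => tiltInt β α δ F p.1 p.2)
      (-tiltInt β α δ (fun T => (∑ j, T j) * F T) p.1 p.2 • ContinuousLinearMap.fst ℝ ℝ ℝ -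
        tiltInt β α δ (fun T => (∑ j, T j * (1 - T j)) * F T) p.1 p.2 •
          ContinuousLinearMap.snd ℝ ℝ ℝ) p := by
  have hGc : Continuous fun T : Fin n → ℝ => ∑ j, T j := by fun_prop
  have hPc : Continuous fun T : Fin n → ℝ => ∑ j, T j * (1 - T j) := by fun_prop
  obtain ⟨c₁, h₁⟩ := exists_bound_on_cube hGc
  obtain ⟨c₂, h₂⟩ := exists_bound_on_cube hPc
  have key := hasFDerivAt_integral_mul_exp_linear (integrable_mul_jacW hβ hα hδ hF)
    hGc.aestronglyMeasurable hPc.aestronglyMeasurable (c := max c₁ c₂)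
    (ae_restrict_of_forall_mem measurableSet_Icc fun T hT => (h₁ T hT).trans (le_max_left _ _))
    (ae_restrict_of_forall_mem measurableSet_Icc fun T hT => (h₂ T hT).trans (le_max_right _ _)) p
  have hcomm : ∀ a b c d : ℝ, a * (b * c) * d = a * b * d * c := fun a b c d => by ring
  have hcomm' : ∀ b c d : ℝ, b * c * d = b * d * c := fun b c d => by ring
  simp only [tiltInt, tilt_eq]
  simp only [hcomm] at key
  simp only [hcomm' _ (jacW β α δ n _) (Real.exp _)] at key
  exact key

lemma contDiff_tiltInt (hβ : 0 ≤ β) (hα : -1 < α) (hδ : -2 < δ) (hF : Continuous F) :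
    ContDiff ℝ ((⊤ : ℕ∞) : WithTop ℕ∞) (fun p : ℝ × ℝ => tiltInt β α δ F p.1 p.2) := by
  rw [contDiff_infty]
  intro m
  induction m generalizing F with
  | zero =>
    refine contDiff_zero.2 (continuous_iff_continuousAt.2 fun p => ?_)
    exact (hasFDerivAt_tiltInt hβ hα hδ hF p).continuousAt
  | succ m ih =>
    refine contDiff_succ_iff_hasFDerivAt.2 ⟨_, ?_, fun p => hasFDerivAt_tiltInt hβ hα hδ hF p⟩
    exact ((ih (by fun_prop)).neg.smul contDiff_const).sub ((ih (by fun_prop)).smul contDiff_const)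

lemma tiltInt_one_pos (hβ : 0 ≤ β) (hα : -1 < α) (hδ : -2 < δ) (z w : ℝ) :
    0 < tiltInt β α δ (fun _ : Fin n → ℝ => 1) z w := by
  refine integral_mul_jacW_pos hβ hα hδ (by fun_prop) fun T => ?_
  rw [one_mul]
  exact tilt_pos z w T

lemma tiltInt_add (hβ : 0 ≤ β) (hα : -1 < α) (hδ : -2 < δ) {H : (Fin n → ℝ) → ℝ}
    (hF : Continuous F) (hH : Continuous H) (z w : ℝ) :
    tiltInt β α δ (fun T => F T + H T) z w = tiltInt β α δ F z w + tiltInt β α δ H z w := by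
  unfold tiltInt
  rw [← integral_add (integrable_tiltInt hβ hα hδ hF z w) (integrable_tiltInt hβ hα hδ hH z w)]
  simp only [add_mul]

lemma tiltInt_const_mul (c : ℝ) (F : (Fin n → ℝ) → ℝ) (z w : ℝ) :
    tiltInt β α δ (fun T => c * F T) z w = c * tiltInt β α δ F z w := by
  unfold tiltInt
  rw [← integral_const_mul]
  simp only [mul_assoc]

end

/-- The leading-order shift of the Chebyshev statistics produced by the tilt. -/
noncomputable def tiltShift (β : ℝ) (p : ℕ) (z w : ℝ) : ℝ :=
  if p = 1 then -z / (4 * β) else if p = 2 then w / (8 * β) else 0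

/-- The product of centred Chebyshev statistics indexed by a multiset. -/
noncomputable def centProd (β z w : ℝ) {n : ℕ} (S : Multiset ℕ) (T : Fin n → ℝ) : ℝ :=
  (S.map fun p => chebStat p T - tiltShift β p z w).prod

/-- Tilted expectation of a product of centred Chebyshev statistics. -/
noncomputable def centMoment (β α δ : ℝ) (n : ℕ) (S : Multiset ℕ) (z w : ℝ) : ℝ :=
  tiltInt β α δ (centProd β z w S : (Fin n → ℝ) → ℝ) z w /
    tiltInt β α δ (fun _ : Fin n → ℝ => 1) z w

lemma centProd_cons (β z w : ℝ) {n : ℕ} (p : ℕ) (S : Multiset ℕ) (T : Fin n → ℝ) :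
    centProd β z w (p ::ₘ S) T = (chebStat p T - tiltShift β p z w) * centProd β z w S T := by
  simp [centProd]

@[fun_prop]
lemma continuous_centProd (β z w : ℝ) {n : ℕ} (S : Multiset ℕ) :
    Continuous (centProd β z w S : (Fin n → ℝ) → ℝ) := by
  induction S using Multiset.induction with
  | empty =>
    have : (centProd β z w 0 : (Fin n → ℝ) → ℝ) = fun _ => 1 := by funext T; simp [centProd]
    rw [this]
    exact continuous_const
  | cons p S ih =>
    have : (centProd β z w (p ::ₘ S) : (Fin n → ℝ) → ℝ) =
      fun T => (chebStat p T - tiltShift β p z w) * centProd β z w S T :=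
      funext (centProd_cons β z w p S)
    rw [this]
    fun_prop

lemma contDiff_tiltShift (β : ℝ) (p : ℕ) :
    ContDiff ℝ ((⊤ : ℕ∞) : WithTop ℕ∞) (fun q : ℝ × ℝ => tiltShift β p q.1 q.2) := by
  unfold tiltShift
  split_ifs
  · exact contDiff_fst.neg.div_const _
  · exact contDiff_snd.div_const _
  · exact contDiff_const

lemma contDiff_tiltInt_mul_centProd {β α δ : ℝ} (hβ : 0 ≤ β) (hα : -1 < α) (hδ : -2 < δ) {n : ℕ}
    (S : Multiset ℕ) {F : (Fin n → ℝ) → ℝ} (hF : Continuous F) :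
    ContDiff ℝ ((⊤ : ℕ∞) : WithTop ℕ∞) (fun q : ℝ × ℝ =>
      tiltInt β α δ (fun T => F T * centProd β q.1 q.2 S T) q.1 q.2) := by
  induction S using Multiset.induction generalizing F with
  | empty => simpa [centProd] using contDiff_tiltInt hβ hα hδ hF
  | cons p S ih =>
    have : (fun q : ℝ × ℝ => tiltInt β α δ (fun T => F T * centProd β q.1 q.2 (p ::ₘ S) T) q.1 q.2)
        = fun q => tiltInt β α δ (fun T => (F T * chebStat p T) * centProd β q.1 q.2 S T) q.1 q.2 +
          -tiltShift β p q.1 q.2 *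
            tiltInt β α δ (fun T => F T * centProd β q.1 q.2 S T) q.1 q.2 := by
      funext q
      rw [← tiltInt_const_mul, ← tiltInt_add hβ hα hδ (by fun_prop) (by fun_prop)]
      congr 1
      funext T
      rw [centProd_cons]
      ring
    rw [this]
    exact (ih (by fun_prop)).add ((contDiff_tiltShift β p).neg.mul (ih hF))

lemma contDiff_centMoment {β α δ : ℝ} (hβ : 0 ≤ β) (hα : -1 < α) (hδ : -2 < δ) (n : ℕ)
    (S : Multiset ℕ) :
    ContDiff ℝ ((⊤ : ℕ∞) : WithTop ℕ∞) (fun q : ℝ × ℝ => centMoment β α δ n S q.1 q.2) := by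
  unfold centMoment
  refine ContDiff.div ?_ (contDiff_tiltInt hβ hα hδ (by fun_prop))
    fun q => (tiltInt_one_pos hβ hα hδ _ _).ne'
  simpa using contDiff_tiltInt_mul_centProd hβ hα hδ S (F := fun _ : Fin n → ℝ => 1) (by fun_prop)

lemma centMoment_zero {β α δ : ℝ} (hβ : 0 ≤ β) (hα : -1 < α) (hδ : -2 < δ) (n : ℕ) (z w : ℝ) :
    centMoment β α δ n 0 z w = 1 := by
  have : (centProd β z w 0 : (Fin n → ℝ) → ℝ) = fun _ => 1 := by funext T; simp [centProd]
  rw [centMoment, this, div_self (tiltInt_one_pos hβ hα hδ z w).ne']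

lemma chebStat_zero {n : ℕ} (T : Fin n → ℝ) : chebStat 0 T = n := by
  simp [chebStat]

lemma hasDerivAt_chebStat_update {n : ℕ} (p : ℕ) (i : Fin n) (T : Fin n → ℝ) (t : ℝ) :
    HasDerivAt (fun t => chebStat p (Function.update T i t))
      (2 * p * (Polynomial.Chebyshev.U ℝ (p - 1)).eval (2 * t - 1)) t := by
  unfold chebStat
  have h : ∀ j ∈ (univ : Finset (Fin n)), HasDerivAt
      (fun t => (Polynomial.Chebyshev.T ℝ p).eval (2 * Function.update T i t j - 1))
      (if j = i then 2 * p * (Polynomial.Chebyshev.U ℝ (p - 1)).eval (2 * t - 1) else 0) t := by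
    intro j _
    split_ifs with hj
    · subst hj
      simp only [Function.update_self]
      have h1 : HasDerivAt (fun x : ℝ => 2 * x - 1) 2 t := by
        simpa using ((hasDerivAt_id t).const_mul 2).sub_const 1
      refine (((Polynomial.Chebyshev.T ℝ p).hasDerivAt (2 * t - 1)).comp t h1).congr_deriv ?_
      rw [Polynomial.Chebyshev.T_derivative_eq_U]
      simp
      ring
    · simp only [Function.update_of_ne hj]
      exact hasDerivAt_const _ _
  refine (HasDerivAt.fun_sum h).congr_deriv ?_
  simp

lemma hasDerivAt_centProd_update (β z w : ℝ) {n : ℕ} (S : Multiset ℕ) (i : Fin n) (T : Fin n → ℝ)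
    (t : ℝ) :
    HasDerivAt (fun t => centProd β z w S (Function.update T i t))
      (S.map fun p => centProd β z w (S.erase p) (Function.update T i t) *
        (2 * p * (Polynomial.Chebyshev.U ℝ (p - 1)).eval (2 * t - 1))).sum t := by
  unfold centProd
  have := (HasFDerivAt.multiset_prod (u := S) (x := t)
    (g := fun p t => chebStat p (Function.update T i t) - tiltShift β p z w)
    fun p _ => ((hasDerivAt_chebStat_update p i T t).sub_const _).hasFDerivAt).hasDerivAt
  refine this.congr_deriv ?_
  have h := map_multiset_sum (ContinuousLinearMap.apply ℝ ℝ (1 : ℝ)) (S.map fun p =>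
    ((S.erase p).map fun p => chebStat p (Function.update T i t) - tiltShift β p z w).prod •
      ContinuousLinearMap.toSpanSingleton ℝ
        (2 * p * (Polynomial.Chebyshev.U ℝ (p - 1)).eval (2 * t - 1)))
  simpa [Multiset.map_map] using h

lemma hasDerivAt_tilt_update (z w : ℝ) {n : ℕ} (i : Fin n) (T : Fin n → ℝ) (t : ℝ) :
    HasDerivAt (fun t => tilt z w (Function.update T i t))
      (tilt z w (Function.update T i t) * (-z + w * (2 * t - 1))) t := by
  unfold tilt
  refine HasDerivAt.exp ?_
  have h : ∀ j ∈ (univ : Finset (Fin n)), HasDerivAt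
      (fun t => -(z * Function.update T i t j) -
        w * Function.update T i t j * (1 - Function.update T i t j))
      (if j = i then -z + w * (2 * t - 1) else 0) t := by
    intro j _
    split_ifs with hj
    · subst hj
      simp only [Function.update_self]
      have h0 := hasDerivAt_id t
      refine (((h0.const_mul z).neg).sub ((h0.const_mul w).mul (h0.const_sub 1))).congr_deriv ?_
      simp only [id]
      ring
    · simp only [Function.update_of_ne hj]
      exact hasDerivAt_const _ _
  refine (HasDerivAt.fun_sum h).congr_deriv ?_
  simp

lemma loop_quadratic_identity (b x c : ℕ → ℝ) (β : ℝ) (hc : ∀ p, c p = x p + b p) (h0 : b 0 = 0)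
    (h3 : ∀ p, b (p + 3) = 0) (M : ℕ) :
    -β * (c 0 * c (M + 1) + ∑ i ∈ range M, c (i + 1) * c (M - i)) +
      β * ∑ p ∈ range 2, b (p + 1) *
        (c (((M + 1 : ℕ) : ℤ) - (p + 1 : ℕ)).natAbs - c (M + 1 + (p + 1))) =
    -β * (x 0 * x (M + 1) + ∑ i ∈ range M, x (i + 1) * x (M - i)) +
      β * ∑ p ∈ range 2, b (p + 1) *
        (((((p + 1 : ℕ) : ℤ) - (M + 1 : ℕ)).sign : ℝ) * x (((M + 1 : ℕ) : ℤ) - (p + 1 : ℕ)).natAbs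
          - x (M + 1 + (p + 1))) := by
  match M with
  | 0 => simp [sum_range_succ, hc, h0, h3]; ring
  | 1 => simp [sum_range_succ, hc, h0, h3]; ring
  | M + 2 =>
    have e1 : (((M + 2 + 1 : ℕ) : ℤ) - (0 + 1 : ℕ)).natAbs = M + 2 := by omega
    have e2 : (((M + 2 + 1 : ℕ) : ℤ) - (1 + 1 : ℕ)).natAbs = M + 1 := by omega
    have s1 : (((0 + 1 : ℕ) : ℤ) - (M + 2 + 1 : ℕ)).sign = -1 := Int.sign_eq_neg_one_of_neg (by omega)
    have s2 : (((1 + 1 : ℕ) : ℤ) - (M + 2 + 1 : ℕ)).sign = -1 := Int.sign_eq_neg_one_of_neg (by omega)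
    have hr : ∑ i ∈ range (M + 2), x (i + 1) * b (M + 2 - i) =
        ∑ i ∈ range (M + 2), b (i + 1) * x (M + 2 - i) := by
      rw [← sum_range_reflect]
      refine sum_congr rfl fun i hi => ?_
      rw [mem_range] at hi
      rw [show M + 2 - 1 - i + 1 = M + 2 - i by omega, show M + 2 - (M + 2 - 1 - i) = i + 1 by omega,
        mul_comm]
    have hs : ∀ f : ℕ → ℝ, ∑ i ∈ range (M + 2), b (i + 1) * f i = b 1 * f 0 + b 2 * f 1 := by
      intro f
      rw [sum_range_succ', sum_range_succ']
      simp [h3]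
      ring
    have hq : ∑ i ∈ range (M + 2), c (i + 1) * c (M + 2 - i) =
        ∑ i ∈ range (M + 2), x (i + 1) * x (M + 2 - i) +
          (∑ i ∈ range (M + 2), b (i + 1) * x (M + 2 - i) +
          ∑ i ∈ range (M + 2), x (i + 1) * b (M + 2 - i) +
          ∑ i ∈ range (M + 2), b (i + 1) * b (M + 2 - i)) := by
      simp only [← sum_add_distrib, hc]
      exact sum_congr rfl fun i _ => by ring
    rw [hq, hr, hs, hs]
    have h2 : ∀ f : ℕ → ℝ, ∑ p ∈ range 2, f p = f 0 + f 1 := fun f => by simp [sum_range_succ]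
    rw [h2, h2, e1, e2, s1, s2]
    have a1 : b (M + 2 + 1) = 0 := h3 _
    have a2 : b (M + 2 + 1 + (0 + 1)) = 0 := h3 (M + 1)
    have a3 : b (M + 2 + 1 + (1 + 1)) = 0 := h3 (M + 2)
    simp only [hc, h0, a1, a2, a3]
    simp
    ring

lemma sum_vector_field_mul_U {n : ℕ} (M p : ℕ) (T : Fin n → ℝ) :
    ∑ i, (1 - (2 * T i - 1) ^ 2) / 2 * (Polynomial.Chebyshev.U ℝ M).eval (2 * T i - 1) *
        (2 * (p * (Polynomial.Chebyshev.U ℝ (p - 1)).eval (2 * T i - 1))) =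
      p / 2 * (chebStat (((M + 1 : ℕ) : ℤ) - (p : ℕ)).natAbs T - chebStat (M + 1 + p) T) := by
  unfold chebStat
  rw [← sum_sub_distrib, mul_sum]
  refine sum_congr rfl fun i _ => ?_
  have h := cheb_vector_field_mul_U ((M + 1 : ℕ) : ℤ) p (2 * T i - 1)
  rw [Polynomial.Chebyshev.T_natAbs, Nat.cast_add (M + 1) p]
  have e : (((M + 1 : ℕ) : ℤ) - 1) = M := by push_cast; ring
  rw [e] at h
  linear_combination (p : ℝ) * h

/-- The tilted expectation, as a linear functional on continuous functions. -/
noncomputable def tiltE {β α δ : ℝ} (hβ : 0 ≤ β) (hα : -1 < α) (hδ : -2 < δ) (n : ℕ) (z w : ℝ) :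
    C(Fin n → ℝ, ℝ) →ₗ[ℝ] ℝ where
  toFun F := tiltInt β α δ F z w / tiltInt β α δ (fun _ : Fin n → ℝ => 1) z w
  map_add' F G := by
    rw [← add_div, ← tiltInt_add hβ hα hδ F.continuous G.continuous]
    rfl
  map_smul' c F := by
    rw [RingHom.id_apply, smul_eq_mul, ← mul_div_assoc, ← tiltInt_const_mul]
    rfl

/-- `centProd` as a bundled continuous function. -/
noncomputable def centProdMap (β z w : ℝ) (n : ℕ) (S : Multiset ℕ) : C(Fin n → ℝ, ℝ) :=
  ⟨centProd β z w S, continuous_centProd β z w S⟩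

lemma multiset_map_sum_add {ι R : Type*} [AddCommMonoid R] (S : Multiset ℕ) (s : Finset ι)
    (f : ι → ℕ → R) : ∑ i ∈ s, (S.map (f i)).sum = (S.map fun p => ∑ i ∈ s, f i p).sum := by
  induction S using Multiset.induction with
  | empty => simp
  | cons p S ih => simp [sum_add_distrib, ih]

lemma loop_pointwise {β α δ z w : ℝ} (hβ : β ≠ 0) {n : ℕ} (M : ℕ) (S : Multiset ℕ) (T : Fin n → ℝ) :
    centProd β z w S T * (-β * (n * chebStat (M + 1) T +
        ∑ i ∈ range M, chebStat (i + 1) T * chebStat (M - i) T) + n * ellCoef β α δ (M + 1) 0 +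
        ∑ i ∈ range (M + 1), ellCoef β α δ (M + 1) (i + 1) * chebStat (i + 1) T) +
      ∑ i, (1 - (2 * T i - 1) ^ 2) / 2 * (Polynomial.Chebyshev.U ℝ M).eval (2 * T i - 1) *
        ((S.map fun p : ℕ => centProd β z w (S.erase p) T *
          (2 * p * (Polynomial.Chebyshev.U ℝ (p - 1)).eval (2 * T i - 1))).sum +
          centProd β z w S T * (-z + w * (2 * T i - 1))) =
    -β * n * centProd β z w ((M + 1) ::ₘ S) T -
      β * ∑ i ∈ range M, centProd β z w ((i + 1) ::ₘ (M - i) ::ₘ S) T +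
      n * ellCoef β α δ (M + 1) 0 * centProd β z w S T +
      ∑ i ∈ range (M + 1), ellCoef β α δ (M + 1) (i + 1) *
        (centProd β z w ((i + 1) ::ₘ S) T + tiltShift β (i + 1) z w * centProd β z w S T) +
      β * ∑ p ∈ range 2, tiltShift β (p + 1) z w *
        (((((p + 1 : ℕ) : ℤ) - (M + 1 : ℕ)).sign : ℝ) *
          centProd β z w ((((M + 1 : ℕ) : ℤ) - (p + 1 : ℕ)).natAbs ::ₘ S) T -
          centProd β z w ((M + 1 + (p + 1)) ::ₘ S) T) +
      (S.map fun p : ℕ => (p : ℝ) / 2 * (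
        (centProd β z w ((((M + 1 : ℕ) : ℤ) - p).natAbs ::ₘ S.erase p) T +
          tiltShift β (((M + 1 : ℕ) : ℤ) - p).natAbs z w * centProd β z w (S.erase p) T) -
        (centProd β z w ((M + 1 + p) ::ₘ S.erase p) T +
          tiltShift β (M + 1 + p) z w * centProd β z w (S.erase p) T))).sum := by
  have hquad := loop_quadratic_identity (fun p => tiltShift β p z w)
    (fun p => chebStat p T - tiltShift β p z w) (fun p => chebStat p T) β (fun p => by ring)
    (by simp [tiltShift]) (fun p => by simp [tiltShift]) M
  have hS : ∑ i, (1 - (2 * T i - 1) ^ 2) / 2 * (Polynomial.Chebyshev.U ℝ M).eval (2 * T i - 1) *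
        ((S.map fun p : ℕ => centProd β z w (S.erase p) T *
          (2 * p * (Polynomial.Chebyshev.U ℝ (p - 1)).eval (2 * T i - 1))).sum) =
      (S.map fun p : ℕ => (p : ℝ) / 2 * (
        (centProd β z w ((((M + 1 : ℕ) : ℤ) - p).natAbs ::ₘ S.erase p) T +
          tiltShift β (((M + 1 : ℕ) : ℤ) - p).natAbs z w * centProd β z w (S.erase p) T) -
        (centProd β z w ((M + 1 + p) ::ₘ S.erase p) T +
          tiltShift β (M + 1 + p) z w * centProd β z w (S.erase p) T))).sum := by
    simp only [← Multiset.sum_map_mul_left]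
    rw [multiset_map_sum_add]
    congr 1
    refine Multiset.map_congr rfl fun p _ => ?_
    have h := sum_vector_field_mul_U M p T
    simp only [centProd_cons]
    have e : ∀ i, (1 - (2 * T i - 1) ^ 2) / 2 * (Polynomial.Chebyshev.U ℝ M).eval (2 * T i - 1) *
        (centProd β z w (S.erase p) T *
          (2 * p * (Polynomial.Chebyshev.U ℝ (p - 1)).eval (2 * T i - 1))) =
        centProd β z w (S.erase p) T * ((1 - (2 * T i - 1) ^ 2) / 2 *
          (Polynomial.Chebyshev.U ℝ M).eval (2 * T i - 1) *
        (2 * (p * (Polynomial.Chebyshev.U ℝ (p - 1)).eval (2 * T i - 1)))) := fun i => by ring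
    simp only [e]
    rw [← mul_sum, h]
    ring
  have hW : ∑ i, (1 - (2 * T i - 1) ^ 2) / 2 * (Polynomial.Chebyshev.U ℝ M).eval (2 * T i - 1) *
        (-z + w * (2 * T i - 1)) =
      β * ∑ p ∈ range 2, tiltShift β (p + 1) z w *
        (chebStat (((M + 1 : ℕ) : ℤ) - (p + 1 : ℕ)).natAbs T - chebStat (M + 1 + (p + 1)) T) := by
    have h1 := sum_vector_field_mul_U M 1 T
    have h2 := sum_vector_field_mul_U M 2 T
    have e1 : tiltShift β 1 z w = -z / (4 * β) := by simp [tiltShift]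
    have e2 : tiltShift β 2 z w = w / (8 * β) := by simp [tiltShift]
    have h3 : ∀ f : ℕ → ℝ, ∑ p ∈ range 2, f p = f 0 + f 1 := fun f => by simp [sum_range_succ]
    rw [h3, zero_add, e1, e2]
    have e3 : ∑ i, (1 - (2 * T i - 1) ^ 2) / 2 * (Polynomial.Chebyshev.U ℝ M).eval (2 * T i - 1) *
        (-z + w * (2 * T i - 1)) = -z / 2 * ∑ i, (1 - (2 * T i - 1) ^ 2) / 2 *
          (Polynomial.Chebyshev.U ℝ M).eval (2 * T i - 1) *
        (2 * ((1 : ℕ) * (Polynomial.Chebyshev.U ℝ ((1 : ℕ) - 1)).eval (2 * T i - 1))) +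
        w / 8 * ∑ i, (1 - (2 * T i - 1) ^ 2) / 2 *
          (Polynomial.Chebyshev.U ℝ M).eval (2 * T i - 1) *
        (2 * ((2 : ℕ) * (Polynomial.Chebyshev.U ℝ ((2 : ℕ) - 1)).eval (2 * T i - 1))) := by
      rw [mul_sum, mul_sum, ← sum_add_distrib]
      refine sum_congr rfl fun i _ => ?_
      norm_num
      ring
    rw [e3, h1, h2]
    push_cast
    field_simp
    ring
  simp only [mul_add _ (Multiset.sum _), sum_add_distrib, hS]
  have e4 : ∑ i, (1 - (2 * T i - 1) ^ 2) / 2 * (Polynomial.Chebyshev.U ℝ M).eval (2 * T i - 1) *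
        (centProd β z w S T * (-z + w * (2 * T i - 1))) =
      centProd β z w S T * ∑ i, (1 - (2 * T i - 1) ^ 2) / 2 *
        (Polynomial.Chebyshev.U ℝ M).eval (2 * T i - 1) * (-z + w * (2 * T i - 1)) := by
    rw [mul_sum]
    exact sum_congr rfl fun i _ => by ring
  rw [e4, hW]
  have f1 : ∑ i ∈ range M, centProd β z w ((i + 1) ::ₘ (M - i) ::ₘ S) T =
      centProd β z w S T * ∑ i ∈ range M, (chebStat (i + 1) T - tiltShift β (i + 1) z w) *
        (chebStat (M - i) T - tiltShift β (M - i) z w) := by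
    rw [mul_sum]
    exact sum_congr rfl fun i _ => by rw [centProd_cons, centProd_cons]; ring
  have f2 : ∑ i ∈ range (M + 1), ellCoef β α δ (M + 1) (i + 1) *
        (centProd β z w ((i + 1) ::ₘ S) T + tiltShift β (i + 1) z w * centProd β z w S T) =
      centProd β z w S T * ∑ i ∈ range (M + 1), ellCoef β α δ (M + 1) (i + 1) *
        chebStat (i + 1) T := by
    rw [mul_sum]
    exact sum_congr rfl fun i _ => by rw [centProd_cons]; ring
  have f3 : ∑ p ∈ range 2, tiltShift β (p + 1) z w *
        (((((p + 1 : ℕ) : ℤ) - (M + 1 : ℕ)).sign : ℝ) *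
          centProd β z w ((((M + 1 : ℕ) : ℤ) - (p + 1 : ℕ)).natAbs ::ₘ S) T -
          centProd β z w ((M + 1 + (p + 1)) ::ₘ S) T) =
      centProd β z w S T * ∑ p ∈ range 2, tiltShift β (p + 1) z w *
        (((((p + 1 : ℕ) : ℤ) - (M + 1 : ℕ)).sign : ℝ) *
          (chebStat (((M + 1 : ℕ) : ℤ) - (p + 1 : ℕ)).natAbs T -
            tiltShift β (((M + 1 : ℕ) : ℤ) - (p + 1 : ℕ)).natAbs z w) -
          (chebStat (M + 1 + (p + 1)) T - tiltShift β (M + 1 + (p + 1)) z w)) := by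
    rw [mul_sum]
    exact sum_congr rfl fun i _ => by rw [centProd_cons, centProd_cons]; ring
  rw [f1, f2, f3, centProd_cons]
  simp only [chebStat_zero] at hquad
  have t0 : tiltShift β 0 z w = 0 := by simp [tiltShift]
  rw [t0] at hquad
  linear_combination centProd β z w S T * hquad

/-- The loop equation for the centred tilted moments. -/
theorem centMoment_loop {β α δ : ℝ} (hβ : 1 ≤ β) (hα : -1 < α) (hδ : -2 < δ) (n : ℕ) (z w : ℝ)
    (M : ℕ) (S : Multiset ℕ) :
    n * β * centMoment β α δ n ((M + 1) ::ₘ S) z w =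
      -β * ∑ i ∈ range M, centMoment β α δ n ((i + 1) ::ₘ (M - i) ::ₘ S) z w +
      n * ellCoef β α δ (M + 1) 0 * centMoment β α δ n S z w +
      ∑ i ∈ range (M + 1), ellCoef β α δ (M + 1) (i + 1) *
        (centMoment β α δ n ((i + 1) ::ₘ S) z w +
          tiltShift β (i + 1) z w * centMoment β α δ n S z w) +
      β * ∑ p ∈ range 2, tiltShift β (p + 1) z w *
        (((((p + 1 : ℕ) : ℤ) - (M + 1 : ℕ)).sign : ℝ) *
          centMoment β α δ n ((((M + 1 : ℕ) : ℤ) - (p + 1 : ℕ)).natAbs ::ₘ S) z w -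
          centMoment β α δ n ((M + 1 + (p + 1)) ::ₘ S) z w) +
      (S.map fun p : ℕ => (p : ℝ) / 2 * (
        (centMoment β α δ n ((((M + 1 : ℕ) : ℤ) - p).natAbs ::ₘ S.erase p) z w +
          tiltShift β (((M + 1 : ℕ) : ℤ) - p).natAbs z w * centMoment β α δ n (S.erase p) z w) -
        (centMoment β α δ n ((M + 1 + p) ::ₘ S.erase p) z w +
          tiltShift β (M + 1 + p) z w * centMoment β α δ n (S.erase p) z w))).sum := by
  have hβ0 : 0 ≤ β := zero_le_one.trans hβ
  set P := centProdMap β z w n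
  let Φ : C(Fin n → ℝ, ℝ) :=
    -(β * n) • P ((M + 1) ::ₘ S) -
      β • ∑ i ∈ range M, P ((i + 1) ::ₘ (M - i) ::ₘ S) +
      (n * ellCoef β α δ (M + 1) 0) • P S +
      ∑ i ∈ range (M + 1), ellCoef β α δ (M + 1) (i + 1) •
        (P ((i + 1) ::ₘ S) + tiltShift β (i + 1) z w • P S) +
      β • ∑ p ∈ range 2, tiltShift β (p + 1) z w •
        (((((p + 1 : ℕ) : ℤ) - (M + 1 : ℕ)).sign : ℝ) •
          P ((((M + 1 : ℕ) : ℤ) - (p + 1 : ℕ)).natAbs ::ₘ S) - P ((M + 1 + (p + 1)) ::ₘ S)) +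
      (S.map fun p : ℕ => ((p : ℝ) / 2) • (
        (P ((((M + 1 : ℕ) : ℤ) - p).natAbs ::ₘ S.erase p) +
          tiltShift β (((M + 1 : ℕ) : ℤ) - p).natAbs z w • P (S.erase p)) -
        (P ((M + 1 + p) ::ₘ S.erase p) + tiltShift β (M + 1 + p) z w • P (S.erase p)))).sum
  have hloop := loop_identity hβ hα hδ (n := n) M
    (F := fun T => centProd β z w S T * tilt z w T)
    (F' := fun i T => ((S.map fun p : ℕ => centProd β z w (S.erase p) T *
        (2 * p * (Polynomial.Chebyshev.U ℝ (p - 1)).eval (2 * T i - 1))).sum +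
      centProd β z w S T * (-z + w * (2 * T i - 1))) * tilt z w T)
    (by fun_prop) (fun i => by
      refine (Continuous.add ?_ (by fun_prop)).mul (by fun_prop)
      refine continuous_multiset_sum _ fun p _ => ?_
      exact (by fun_prop : Continuous fun T => centProd β z w (S.erase p) T).mul (by fun_prop))
    (fun i T t => by
      refine ((hasDerivAt_centProd_update β z w S i T t).mul
        (hasDerivAt_tilt_update z w i T t)).congr_deriv ?_
      simp only [Function.update_self]
      ring)
  have hΦ : tiltE hβ0 hα hδ n z w Φ = 0 := by
    change tiltInt β α δ Φ z w / _ = 0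
    rw [div_eq_zero_iff]
    left
    rw [← hloop]
    unfold tiltInt
    congr 1
    funext T
    congr 1
    have h := loop_pointwise (α := α) (δ := δ) (z := z) (w := w) (by positivity : β ≠ 0) M S T
    have hT : Φ T = _ := Eq.trans ?_ h.symm
    · rw [hT, add_mul, sum_mul]
      congr 1
      · ring
      · exact sum_congr rfl fun i _ => by ring
    · change ContinuousMap.evalAlgHom ℝ ℝ T Φ = _
      have hP : ∀ S, ContinuousMap.evalAlgHom ℝ ℝ T (P S) = centProd β z w S T := fun _ => rfl
      simp only [Φ, map_add, map_sub, map_smul, map_sum, map_multiset_sum, Multiset.map_map, hP,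
        smul_eq_mul, Function.comp_def]
      ring
  have hP : ∀ S, tiltE hβ0 hα hδ n z w (P S) = centMoment β α δ n S z w := fun _ => rfl
  simp only [Φ, map_add, map_sub, map_smul, map_sum, map_multiset_sum, Multiset.map_map, hP,
    smul_eq_mul, Function.comp_def] at hΦ
  linear_combination -hΦ

/-- The space of jointly smooth functions of two real variables. -/
def smoothTwo : Submodule ℝ (ℝ → ℝ → ℝ) where
  carrier := {g | ContDiff ℝ ((⊤ : ℕ∞) : WithTop ℕ∞) fun q : ℝ × ℝ => g q.1 q.2}
  add_mem' := by
    intro f g hf hg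
    rw [Set.mem_ofPred_eq] at *
    exact ContDiff.add hf hg
  zero_mem' := by
    rw [Set.mem_ofPred_eq]
    exact contDiff_const
  smul_mem' := by
    intro c g hg
    rw [Set.mem_ofPred_eq] at *
    exact (contDiff_const (c := c)).mul hg

lemma mem_smoothTwo {g : ℝ → ℝ → ℝ} :
    g ∈ smoothTwo ↔ ContDiff ℝ ((⊤ : ℕ∞) : WithTop ℕ∞) fun q : ℝ × ℝ => g q.1 q.2 := Iff.rfl

lemma deriv_snd_mem_smoothTwo {g : ℝ → ℝ → ℝ} (hg : g ∈ smoothTwo) :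
    (fun z => deriv (g z)) ∈ smoothTwo := by
  have hg' : ContDiff ℝ ((⊤ : ℕ∞) : WithTop ℕ∞) fun q : ℝ × ℝ => g q.1 q.2 :=
    mem_smoothTwo.1 hg
  have h : ∀ q : ℝ × ℝ, deriv (g q.1) q.2 =
      fderiv ℝ (fun q : ℝ × ℝ => g q.1 q.2) q (0, 1) := by
    intro q
    have h1 : HasFDerivAt (fun q : ℝ × ℝ => g q.1 q.2) (fderiv ℝ (fun q : ℝ × ℝ => g q.1 q.2) q)
        (q.1, q.2) := ((hg'.differentiable (by simp)) q).hasFDerivAt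
    have h2 : HasDerivAt (fun w : ℝ => (q.1, w)) ((0 : ℝ), (1 : ℝ)) q.2 :=
      (hasDerivAt_const _ _).prodMk (hasDerivAt_id _)
    exact (h1.comp_hasDerivAt q.2 h2).deriv
  rw [mem_smoothTwo]
  simp only [h]
  exact (hg'.fderiv_right (by simp)).clm_apply contDiff_const

lemma iteratedDeriv_snd_mem_smoothTwo {g : ℝ → ℝ → ℝ} (hg : g ∈ smoothTwo) (k : ℕ) :
    (fun z => iteratedDeriv k (g z)) ∈ smoothTwo := by
  induction k with
  | zero => simpa using hg
  | succ k ih => simpa only [iteratedDeriv_succ] using deriv_snd_mem_smoothTwo ih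

lemma contDiff_iteratedDeriv_snd {g : ℝ → ℝ → ℝ} (hg : g ∈ smoothTwo) (k : ℕ) (w : ℝ) :
    ContDiff ℝ ((⊤ : ℕ∞) : WithTop ℕ∞) fun z => iteratedDeriv k (g z) w :=
  (mem_smoothTwo.1 (iteratedDeriv_snd_mem_smoothTwo hg k)).comp (contDiff_id.prodMk contDiff_const)

lemma contDiff_of_mem_smoothTwo {g : ℝ → ℝ → ℝ} (hg : g ∈ smoothTwo) (z : ℝ) :
    ContDiff ℝ ((⊤ : ℕ∞) : WithTop ℕ∞) (g z) :=
  (mem_smoothTwo.1 hg).comp (contDiff_const.prodMk contDiff_id)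

/-- The mixed derivative `∂_z^l ∂_w^k` at the origin. -/
noncomputable def mixD (l k : ℕ) (g : ℝ → ℝ → ℝ) : ℝ :=
  iteratedDeriv l (fun z => iteratedDeriv k (fun w => g z w) 0) 0

/-- The mixed derivative at the origin as a linear functional on smooth functions. -/
noncomputable def mixDMap (l k : ℕ) : smoothTwo →ₗ[ℝ] ℝ where
  toFun g := mixD l k g
  map_add' f g := by
    have h : (fun z => iteratedDeriv k (fun w => (f + g : smoothTwo).1 z w) 0) =
        fun z => iteratedDeriv k (f.1 z) 0 + iteratedDeriv k (g.1 z) 0 := by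
      funext z
      exact iteratedDeriv_fun_add ((contDiff_of_mem_smoothTwo f.2 z).of_le (mod_cast le_top)).contDiffAt
        ((contDiff_of_mem_smoothTwo g.2 z).of_le (mod_cast le_top)).contDiffAt
    unfold mixD
    rw [h]
    exact iteratedDeriv_fun_add
      ((contDiff_iteratedDeriv_snd f.2 k 0).of_le (mod_cast le_top)).contDiffAt
      ((contDiff_iteratedDeriv_snd g.2 k 0).of_le (mod_cast le_top)).contDiffAt
  map_smul' c g := by
    have h : (fun z => iteratedDeriv k (fun w => (c • g : smoothTwo).1 z w) 0) =
        fun z => c * iteratedDeriv k (g.1 z) 0 := by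
      funext z
      exact iteratedDeriv_const_mul_field c (g.1 z)
    unfold mixD
    rw [h]
    exact iteratedDeriv_const_mul_field c _

lemma iteratedDeriv_id_mul_zero {f : ℝ → ℝ} (hf : ContDiff ℝ ((⊤ : ℕ∞) : WithTop ℕ∞) f) (k : ℕ) :
    iteratedDeriv k (fun w => w * f w) 0 = k * iteratedDeriv (k - 1) f 0 := by
  induction k generalizing f with
  | zero => simp
  | succ k ih =>
    have hd := hf.differentiable (by simp)
    have hf' : ContDiff ℝ ((⊤ : ℕ∞) : WithTop ℕ∞) (deriv f) := (contDiff_infty_iff_deriv.1 hf).2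
    have h : deriv (fun w => w * f w) = fun w => f w + w * deriv f w := by
      funext w
      exact (((hasDerivAt_id w).mul (hd w).hasDerivAt).deriv).trans (by simp)
    rw [iteratedDeriv_succ', h, iteratedDeriv_fun_add (hf.of_le (mod_cast le_top)).contDiffAt
      (g := fun w => w * deriv f w) ((contDiff_id.mul hf').of_le (mod_cast le_top)).contDiffAt,
      ih hf']
    cases k with
    | zero => simp
    | succ k =>
      simp only [Nat.add_sub_cancel]
      rw [iteratedDeriv_succ']
      push_cast
      ring

lemma mixD_fst_mul {g : ℝ → ℝ → ℝ} (hg : g ∈ smoothTwo) (l k : ℕ) :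
    mixD l k (fun z w => z * g z w) = l * mixD (l - 1) k g := by
  unfold mixD
  have h : (fun z => iteratedDeriv k (fun w => z * g z w) 0) =
      fun z => z * iteratedDeriv k (g z) 0 := by
    funext z
    exact iteratedDeriv_const_mul_field z (g z)
  rw [h, iteratedDeriv_id_mul_zero (contDiff_iteratedDeriv_snd hg k 0)]

lemma mixD_snd_mul {g : ℝ → ℝ → ℝ} (hg : g ∈ smoothTwo) (l k : ℕ) :
    mixD l k (fun z w => w * g z w) = k * mixD l (k - 1) g := by
  unfold mixD
  have h : (fun z => iteratedDeriv k (fun w => w * g z w) 0) =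
      fun z => k * iteratedDeriv (k - 1) (g z) 0 := by
    funext z
    exact iteratedDeriv_id_mul_zero (contDiff_of_mem_smoothTwo hg z) k
  rw [h]
  exact iteratedDeriv_const_mul_field _ _

/-- The action of multiplication by `tiltShift` on mixed derivatives at the origin. -/
noncomputable def shiftOp (β : ℝ) (p : ℕ) (y : ℕ → ℕ → ℝ) (l k : ℕ) : ℝ :=
  if p = 1 then -(l / (4 * β)) * y (l - 1) k
  else if p = 2 then k / (8 * β) * y l (k - 1) else 0

lemma tiltShift_mul_mem_smoothTwo (β : ℝ) (p : ℕ) {g : ℝ → ℝ → ℝ} (hg : g ∈ smoothTwo) :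
    (fun z w => tiltShift β p z w * g z w) ∈ smoothTwo :=
  mem_smoothTwo.2 ((contDiff_tiltShift β p).mul (mem_smoothTwo.1 hg))

lemma mixD_tiltShift_mul (β : ℝ) (p : ℕ) {g : ℝ → ℝ → ℝ} (hg : g ∈ smoothTwo) (l k : ℕ) :
    mixD l k (fun z w => tiltShift β p z w * g z w) = shiftOp β p (fun l k => mixD l k g) l k := by
  unfold tiltShift shiftOp
  split_ifs with h1 h2
  · have h := (mixDMap l k).map_smul (-(1 / (4 * β)))
      ⟨fun z w => z * g z w, mem_smoothTwo.2 (contDiff_fst.mul (mem_smoothTwo.1 hg))⟩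
    have h' : mixD l k (fun z w => -(1 / (4 * β)) * (z * g z w)) =
      -(1 / (4 * β)) * mixD l k (fun z w => z * g z w) := h
    rw [mixD_fst_mul hg] at h'
    have e : (fun z w => -z / (4 * β) * g z w) = fun z w => -(1 / (4 * β)) * (z * g z w) := by
      funext z w; ring
    rw [e, h']
    ring
  · have h := (mixDMap l k).map_smul (1 / (8 * β))
      ⟨fun z w => w * g z w, mem_smoothTwo.2 (contDiff_snd.mul (mem_smoothTwo.1 hg))⟩
    have h' : mixD l k (fun z w => 1 / (8 * β) * (w * g z w)) =
      1 / (8 * β) * mixD l k (fun z w => w * g z w) := h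
    rw [mixD_snd_mul hg] at h'
    have e : (fun z w => w / (8 * β) * g z w) = fun z w => 1 / (8 * β) * (w * g z w) := by
      funext z w; ring
    rw [e, h']
    ring
  · have h := (mixDMap l k).map_zero
    have h' : mixD l k (fun _ _ => 0) = 0 := h
    simpa using h'

/-- Evaluation at a point as a linear functional. -/
def smoothTwoEval (z w : ℝ) : smoothTwo →ₗ[ℝ] ℝ where
  toFun g := g.1 z w
  map_add' _ _ := rfl
  map_smul' _ _ := rfl

lemma smoothTwo_ext {f g : smoothTwo} (h : ∀ z w, smoothTwoEval z w f = smoothTwoEval z w g) :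
    f = g :=
  Subtype.ext (funext fun z => funext fun w => h z w)

/-- Mixed derivatives at the origin of the centred moments, in their natural scaling. -/
noncomputable def momD (β α δ : ℝ) (n : ℕ) (S : Multiset ℕ) (l k : ℕ) : ℝ :=
  n ^ (l + k) * mixD l k (centMoment β α δ n S)

lemma shiftOp_scale (β : ℝ) (p : ℕ) (y : ℕ → ℕ → ℝ) (l k : ℕ) (c : ℝ) :
    c ^ (l + k) * shiftOp β p y l k = c * shiftOp β p (fun l k => c ^ (l + k) * y l k) l k := by
  unfold shiftOp
  split_ifs with h1 h2
  · cases l with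
    | zero => simp
    | succ l =>
      simp only [Nat.add_sub_cancel]
      rw [show l + 1 + k = l + k + 1 by ring, pow_succ]
      ring
  · cases k with
    | zero => simp
    | succ k =>
      simp only [Nat.add_sub_cancel]
      rw [show l + (k + 1) = l + k + 1 by ring, pow_succ]
      ring
  · simp

/-- The loop equation for the scaled mixed derivatives. -/
theorem momD_loop {β α δ : ℝ} (hβ : 1 ≤ β) (hα : -1 < α) (hδ : -2 < δ) {n : ℕ} (hn : n ≠ 0)
    (M : ℕ) (S : Multiset ℕ) (l k : ℕ) :
    β * momD β α δ n ((M + 1) ::ₘ S) l k =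
      ellCoef β α δ (M + 1) 0 * momD β α δ n S l k +
      ∑ i ∈ range (M + 1), ellCoef β α δ (M + 1) (i + 1) *
        shiftOp β (i + 1) (momD β α δ n S) l k +
      β * ∑ p ∈ range 2,
        (((((p + 1 : ℕ) : ℤ) - (M + 1 : ℕ)).sign : ℝ) *
          shiftOp β (p + 1) (momD β α δ n ((((M + 1 : ℕ) : ℤ) - (p + 1 : ℕ)).natAbs ::ₘ S)) l k -
          shiftOp β (p + 1) (momD β α δ n ((M + 1 + (p + 1)) ::ₘ S)) l k) +
      (S.map fun p : ℕ => (p : ℝ) / 2 * (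
        shiftOp β (((M + 1 : ℕ) : ℤ) - p).natAbs (momD β α δ n (S.erase p)) l k -
          shiftOp β (M + 1 + p) (momD β α δ n (S.erase p)) l k)).sum +
      (n : ℝ)⁻¹ * (-β * ∑ i ∈ range M, momD β α δ n ((i + 1) ::ₘ (M - i) ::ₘ S) l k +
        ∑ i ∈ range (M + 1), ellCoef β α δ (M + 1) (i + 1) * momD β α δ n ((i + 1) ::ₘ S) l k +
        (S.map fun p : ℕ => (p : ℝ) / 2 * (
          momD β α δ n ((((M + 1 : ℕ) : ℤ) - p).natAbs ::ₘ S.erase p) l k -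
            momD β α δ n ((M + 1 + p) ::ₘ S.erase p) l k)).sum) := by
  have hβ0 : 0 ≤ β := zero_le_one.trans hβ
  have hn' : (n : ℝ) ≠ 0 := Nat.cast_ne_zero.2 hn
  let E : Multiset ℕ → smoothTwo := fun S =>
    ⟨centMoment β α δ n S, contDiff_centMoment hβ0 hα hδ n S⟩
  let B : ℕ → Multiset ℕ → smoothTwo := fun p S =>
    ⟨fun z w => tiltShift β p z w * centMoment β α δ n S z w,
      tiltShift_mul_mem_smoothTwo β p (E S).2⟩
  have key : (n * β) • E ((M + 1) ::ₘ S) =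
      -β • ∑ i ∈ range M, E ((i + 1) ::ₘ (M - i) ::ₘ S) +
      (n * ellCoef β α δ (M + 1) 0) • E S +
      ∑ i ∈ range (M + 1), ellCoef β α δ (M + 1) (i + 1) •
        (E ((i + 1) ::ₘ S) + B (i + 1) S) +
      β • ∑ p ∈ range 2,
        (((((p + 1 : ℕ) : ℤ) - (M + 1 : ℕ)).sign : ℝ) •
          B (p + 1) ((((M + 1 : ℕ) : ℤ) - (p + 1 : ℕ)).natAbs ::ₘ S) -
          B (p + 1) ((M + 1 + (p + 1)) ::ₘ S)) +
      (S.map fun p : ℕ => ((p : ℝ) / 2) • (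
        (E ((((M + 1 : ℕ) : ℤ) - p).natAbs ::ₘ S.erase p) +
          B (((M + 1 : ℕ) : ℤ) - p).natAbs (S.erase p)) -
        (E ((M + 1 + p) ::ₘ S.erase p) + B (M + 1 + p) (S.erase p)))).sum := by
    refine smoothTwo_ext fun z w => ?_
    have hE : ∀ S, smoothTwoEval z w (E S) = centMoment β α δ n S z w := fun _ => rfl
    have hB : ∀ p S, smoothTwoEval z w (B p S) = tiltShift β p z w * centMoment β α δ n S z w :=
      fun _ _ => rfl
    simp only [map_add, map_sub, map_smul, map_sum, map_multiset_sum, Multiset.map_map, hE, hB,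
      smul_eq_mul, Function.comp_def]
    have h := centMoment_loop hβ hα hδ n z w M S
    rw [h]
    congr 3
    refine sum_congr rfl fun p _ => ?_
    ring
  let L : smoothTwo →ₗ[ℝ] ℝ := ((n : ℝ) ^ (l + k)) • mixDMap l k
  have hk := congrArg L key
  have hE : ∀ S, L (E S) = momD β α δ n S l k := fun _ => rfl
  have hB : ∀ p S, L (B p S) = n * shiftOp β p (momD β α δ n S) l k := by
    intro p S
    have h : L (B p S) = (n : ℝ) ^ (l + k) *
      mixD l k (fun z w => tiltShift β p z w * centMoment β α δ n S z w) := rfl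
    rw [h, mixD_tiltShift_mul β p (E S).2 l k, shiftOp_scale]
    rfl
  simp only [map_add, map_sub, map_smul, map_sum, map_multiset_sum, Multiset.map_map, hE, hB,
    smul_eq_mul, Function.comp_def] at hk
  have s1 : ∀ (f g : ℕ → ℝ) (c : ℕ → ℝ), ∑ i ∈ range (M + 1), c i * (f i + n * g i) =
      ∑ i ∈ range (M + 1), c i * f i + n * ∑ i ∈ range (M + 1), c i * g i := by
    intro f g c
    rw [mul_sum, ← sum_add_distrib]
    exact sum_congr rfl fun i _ => by ring
  have s2 : ∀ (f g : ℕ → ℝ) (c : ℕ → ℝ), ∑ i ∈ range 2, (c i * (n * f i) - n * g i) =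
      n * ∑ i ∈ range 2, (c i * f i - g i) := by
    intro f g c
    rw [mul_sum]
    exact sum_congr rfl fun i _ => by ring
  have s3 : ∀ (f g h e : ℕ → ℝ), (S.map fun p : ℕ => (p : ℝ) / 2 *
      (f p + n * g p - (h p + n * e p))).sum =
      (S.map fun p : ℕ => (p : ℝ) / 2 * (f p - h p)).sum +
        n * (S.map fun p : ℕ => (p : ℝ) / 2 * (g p - e p)).sum := by
    intro f g h e
    rw [← Multiset.sum_map_mul_left, ← Multiset.sum_map_add]
    congr 1
    exact Multiset.map_congr rfl fun p _ => by ring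
  rw [s1, s2, s3] at hk
  apply mul_left_cancel₀ hn'
  rw [mul_add, mul_inv_cancel_left₀ hn']
  linear_combination hk

section
open Asymptotics

lemma centMoment_zero_cons (β α δ : ℝ) (n : ℕ) (S : Multiset ℕ) (z w : ℝ) :
    centMoment β α δ n (0 ::ₘ S) z w = n * centMoment β α δ n S z w := by
  have h : (centProd β z w (0 ::ₘ S) : (Fin n → ℝ) → ℝ) = fun T => n * centProd β z w S T := by
    funext T
    rw [centProd_cons, chebStat_zero]
    simp [tiltShift]
  rw [centMoment, h, tiltInt_const_mul, mul_div_assoc]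
  rfl

lemma momD_zero_cons {β α δ : ℝ} (hβ : 0 ≤ β) (hα : -1 < α) (hδ : -2 < δ) (n : ℕ)
    (S : Multiset ℕ) (l k : ℕ) : momD β α δ n (0 ::ₘ S) l k = n * momD β α δ n S l k := by
  have h := (mixDMap l k).map_smul (n : ℝ)
    ⟨centMoment β α δ n S, mem_smoothTwo.2 (contDiff_centMoment hβ hα hδ n S)⟩
  have h' : mixD l k (fun z w => n * centMoment β α δ n S z w) =
    n * mixD l k (centMoment β α δ n S) := h
  have e : centMoment β α δ n (0 ::ₘ S) = fun z w => n * centMoment β α δ n S z w :=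
    funext fun z => funext fun w => centMoment_zero_cons β α δ n S z w
  rw [momD, e, h', momD]
  ring

lemma momD_empty {β α δ : ℝ} (hβ : 0 ≤ β) (hα : -1 < α) (hδ : -2 < δ) (n l k : ℕ) :
    momD β α δ n 0 l k = if l + k = 0 then 1 else 0 := by
  have e : centMoment β α δ n 0 = fun _ _ => 1 :=
    funext fun z => funext fun w => centMoment_zero hβ hα hδ n z w
  rw [momD, e, mixD]
  split_ifs with h
  · obtain ⟨rfl, rfl⟩ : l = 0 ∧ k = 0 := by omega
    simp
  · simp only [iteratedDeriv_const]
    by_cases hk : k = 0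
    · subst hk
      simp only [if_true]
      rw [if_neg (by omega), mul_zero]
    · simp [hk]

lemma isBigO_multiset_sum_map {h : ℕ → ℝ} (S : Multiset ℕ) (f : ℕ → ℕ → ℝ)
    (hf : ∀ p ∈ S, (fun n => f n p) =O[atTop] h) :
    (fun n => (S.map (f n)).sum) =O[atTop] h := by
  induction S using Multiset.induction with
  | empty => simpa using isBigO_zero _ _
  | cons p S ih =>
    simp only [Multiset.map_cons, Multiset.sum_cons]
    exact (hf p (by simp)).add (ih fun q hq => hf q (by simp [hq]))

lemma isBigO_shiftOp {β : ℝ} {h : ℕ → ℝ} (p l k : ℕ) (y : ℕ → ℕ → ℕ → ℝ)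
    (hy : ∀ l' k', l' + k' < l + k → (fun n => y n l' k') =O[atTop] h) :
    (fun n => shiftOp β p (y n) l k) =O[atTop] h := by
  unfold shiftOp
  split_ifs with h1 h2
  · rcases Nat.eq_zero_or_pos l with rfl | hl
    · simpa using isBigO_zero _ _
    · exact (hy _ _ (by omega)).const_mul_left _
  · rcases Nat.eq_zero_or_pos k with rfl | hl
    · simpa using isBigO_zero _ _
    · exact (hy _ _ (by omega)).const_mul_left _
  · exact isBigO_zero _ _

lemma isBigO_inv_mul {f h : ℕ → ℝ} (hf : f =O[atTop] h) :
    (fun n : ℕ => (n : ℝ)⁻¹ * f n) =O[atTop] h := by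
  have h1 : (fun n : ℕ => (n : ℝ)⁻¹) =O[atTop] (fun _ => (1 : ℝ)) :=
    (tendsto_inv_atTop_nhds_zero_nat (𝕜 := ℝ)).isBigO_one ℝ
  simpa using h1.mul hf

lemma momD_cons_isBigO {β α δ : ℝ} (hβ : 1 ≤ β) (hα : -1 < α) (hδ : -2 < δ) (M : ℕ)
    (S : Multiset ℕ) (hS : 0 ∉ S) (l k : ℕ) (h : ℕ → ℝ)
    (lower : ∀ l' k' S', l' + k' < l + k → 0 ∉ S' →
      (fun n => momD β α δ n S' l' k') =O[atTop] h)
    (small : ∀ S', 0 ∉ S' → S'.sum < M + 1 + S.sum →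
      (fun n => momD β α δ n S' l k) =O[atTop] h)
    (same : ∀ S', 0 ∉ S' → S'.sum = M + 1 + S.sum →
      (fun n : ℕ => (n : ℝ)⁻¹ * momD β α δ n S' l k) =O[atTop] h) :
    (fun n => momD β α δ n ((M + 1) ::ₘ S) l k) =O[atTop] h := by
  have hβ0 : 0 ≤ β := zero_le_one.trans hβ
  have hβ' : β ≠ 0 := by positivity
  have le : ∀ S', 0 ∉ S' → S'.sum ≤ M + 1 + S.sum →
      (fun n : ℕ => (n : ℝ)⁻¹ * momD β α δ n S' l k) =O[atTop] h := by
    intro S' h0 hs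
    rcases hs.lt_or_eq with hs | hs
    · exact isBigO_inv_mul (small S' h0 hs)
    · exact same S' h0 hs
  have hR := fun n : ℕ => fun hn : n ≠ 0 => momD_loop hβ hα hδ hn M S l k
  have hev : (fun n => β⁻¹ * (β * momD β α δ n ((M + 1) ::ₘ S) l k)) =ᶠ[atTop]
      fun n => momD β α δ n ((M + 1) ::ₘ S) l k := .of_forall fun n => by
    simp only
    rw [inv_mul_cancel_left₀ hβ']
  refine IsBigO.congr' ?_ hev .rfl
  refine IsBigO.const_mul_left ?_ _
  refine IsBigO.congr' ?_ ((eventually_ne_atTop 0).mono fun n hn => (hR n hn).symm) .rfl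
  have hsum : ∀ p ∈ S, p + (S.erase p).sum = S.sum := fun p hp => Multiset.sum_erase hp
  have hcons : ∀ (a : ℕ) (S' : Multiset ℕ), a ≠ 0 → 0 ∉ S' → 0 ∉ a ::ₘ S' := by
    intro a S' ha hS' h0
    rcases Multiset.mem_cons.1 h0 with h0 | h0
    · exact ha h0.symm
    · exact hS' h0
  have herase : ∀ p, 0 ∉ S.erase p := fun p h0 => hS (Multiset.mem_of_mem_erase h0)
  refine ((((IsBigO.add ?_ ?_).add ?_).add ?_).add ?_)
  · exact (small S hS (by omega)).const_mul_left _
  · exact IsBigO.fun_sum fun i _ => (isBigO_shiftOp _ _ _ (fun n => momD β α δ n S)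
      fun l' k' h' => lower l' k' S h' hS).const_mul_left _
  · refine (IsBigO.fun_sum fun p _ => IsBigO.sub ?_ ?_).const_mul_left _
    · by_cases hp : M + 1 = p + 1
      · simpa [hp] using isBigO_zero _ _
      · exact (isBigO_shiftOp _ _ _ (fun n => momD β α δ n _)
          fun l' k' h' => lower l' k' _ h' (hcons _ _ (by omega) hS)).const_mul_left _
    · exact isBigO_shiftOp _ _ _ (fun n => momD β α δ n _)
        fun l' k' h' => lower l' k' _ h' (hcons _ _ (by omega) hS)
  · refine isBigO_multiset_sum_map S _ fun p hp => IsBigO.const_mul_left (IsBigO.sub ?_ ?_) _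
    · exact isBigO_shiftOp _ _ _ (fun n => momD β α δ n _)
        fun l' k' h' => lower l' k' _ h' (herase p)
    · exact isBigO_shiftOp _ _ _ (fun n => momD β α δ n _)
        fun l' k' h' => lower l' k' _ h' (herase p)
  · simp only [mul_add, mul_left_comm (_ : ℝ)⁻¹, mul_sum, ← Multiset.sum_map_mul_left, mul_sub]
    refine (IsBigO.add ?_ ?_).add ?_
    · refine IsBigO.fun_sum fun i hi => IsBigO.const_mul_left (le _ ?_ ?_) _
      · rw [mem_range] at hi
        exact hcons _ _ (by omega) (hcons _ _ (by omega) hS)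
      · rw [mem_range] at hi
        simp only [Multiset.sum_cons]
        omega
    · refine IsBigO.fun_sum fun i hi => IsBigO.const_mul_left (le _ ?_ ?_) _
      · exact hcons _ _ (by omega) hS
      · rw [mem_range] at hi
        simp only [Multiset.sum_cons]
        omega
    · refine isBigO_multiset_sum_map S _ fun p hp => IsBigO.sub ?_ ?_
      · refine IsBigO.const_mul_left ?_ _
        have := hsum p hp
        by_cases hpm : p = M + 1
        · have e : (((M + 1 : ℕ) : ℤ) - p).natAbs = 0 := by omega
          rw [e]
          refine IsBigO.congr' (small (S.erase p) (herase p) (by omega))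
            ((eventually_ne_atTop 0).mono fun n hn => ?_) .rfl
          beta_reduce
          rw [momD_zero_cons hβ0 hα hδ, inv_mul_cancel_left₀ (Nat.cast_ne_zero.2 hn)]
        · refine le _ (hcons _ _ (by omega) (herase p)) ?_
          simp only [Multiset.sum_cons]
          omega
      · refine IsBigO.const_mul_left (le _ (hcons _ _ (by omega) (herase p)) ?_) _
        have := hsum p hp
        simp only [Multiset.sum_cons]
        omega

/-- All scaled mixed derivatives of the centred moments are bounded in `n`. -/
theorem momD_isBigO_one {β α δ : ℝ} (hβ : 1 ≤ β) (hα : -1 < α) (hδ : -2 < δ) (l k : ℕ)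
    (S : Multiset ℕ) (hS : 0 ∉ S) :
    (fun n => momD β α δ n S l k) =O[atTop] (fun _ => (1 : ℝ)) := by
  induction hq : l + k using Nat.strong_induction_on generalizing l k S with
  | _ q ihq =>
  induction hD : S.sum using Nat.strong_induction_on generalizing S with
  | _ D ihD =>
  let g : ℕ → ℝ := fun n => ∑ P : D.Partition, |momD β α δ n P.parts l k|
  let h : ℕ → ℝ := fun n => 1 + (n : ℝ)⁻¹ * g n
  have hg0 : ∀ n, 0 ≤ g n := fun n => sum_nonneg fun P _ => abs_nonneg _
  have hle : ∀ S' : Multiset ℕ, 0 ∉ S' → S'.sum = D → ∀ n, |momD β α δ n S' l k| ≤ g n := by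
    intro S' h0 hs n
    obtain ⟨P, hP⟩ : ∃ P : D.Partition, P.parts = S' :=
      ⟨⟨S', fun {i} hi => Nat.pos_of_ne_zero fun e => h0 (e ▸ hi), hs⟩, rfl⟩
    rw [← hP]
    exact single_le_sum (f := fun P : D.Partition => |momD β α δ n P.parts l k|)
      (fun P _ => abs_nonneg _) (mem_univ P)
  have h1 : (fun _ => (1 : ℝ)) =O[atTop] h := by
    refine IsBigO.of_bound 1 (.of_forall fun n => ?_)
    have : 0 ≤ (n : ℝ)⁻¹ * g n := mul_nonneg (by positivity) (hg0 n)
    rw [one_mul, norm_one, Real.norm_of_nonneg (by positivity)]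
    exact le_add_of_nonneg_right this
  have hY : ∀ S' : Multiset ℕ, 0 ∉ S' → S'.sum = D →
      (fun n => momD β α δ n S' l k) =O[atTop] h := by
    intro S' h0 hs
    induction S' using Multiset.induction with
    | empty =>
      simp only [momD_empty (zero_le_one.trans hβ) hα hδ]
      exact (isBigO_const_const _ one_ne_zero _).trans h1
    | cons m S' _ =>
      obtain ⟨M, rfl⟩ : ∃ M, m = M + 1 :=
        Nat.exists_eq_succ_of_ne_zero fun e => h0 (by simp [e])
      rw [Multiset.sum_cons] at hs
      refine momD_cons_isBigO hβ hα hδ M S' (fun h => h0 (Multiset.mem_cons_of_mem h)) l k h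
        (fun l' k' S'' hlt h0' => (ihq _ (hq ▸ hlt) l' k' S'' h0' rfl).trans h1)
        (fun S'' h0' hlt => (ihD _ (hs ▸ hlt) S'' h0' rfl).trans h1) fun S'' h0' hs' => ?_
      refine IsBigO.of_bound 1 (.of_forall fun n => ?_)
      have h2 := hle S'' h0' (hs' ▸ hs) n
      have h3 : (0 : ℝ) ≤ (n : ℝ)⁻¹ := by positivity
      have h4 := mul_le_mul_of_nonneg_left h2 h3
      have h5 := mul_nonneg h3 (hg0 n)
      rw [norm_mul, Real.norm_of_nonneg h3, Real.norm_eq_abs, Real.norm_of_nonneg (by positivity)]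
      linarith
  have hgh : g =O[atTop] h := by
    refine IsBigO.fun_sum fun P _ => ?_
    refine (hY P.parts (fun h0 => absurd (P.parts_pos h0) (lt_irrefl 0)) P.parts_sum).abs_left
  obtain ⟨c, hc, hb⟩ := hgh.exists_pos
  refine IsBigO.of_bound (2 * c) ?_
  filter_upwards [hb.bound, eventually_ge_atTop (max 1 ⌈2 * c⌉₊)] with n hn hn'
  have hn1 : 1 ≤ n := (le_max_left _ _).trans hn'
  have hn2 : 2 * c ≤ n := (Nat.le_ceil _).trans (Nat.cast_le.2 ((le_max_right _ _).trans hn'))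
  have hnpos : (0 : ℝ) < n := by exact_mod_cast hn1
  have h5 : 0 ≤ (n : ℝ)⁻¹ * g n := mul_nonneg (by positivity) (hg0 n)
  rw [Real.norm_of_nonneg (hg0 n), Real.norm_of_nonneg (by positivity)] at hn
  rw [norm_one, mul_one, Real.norm_eq_abs]
  refine (hle S hS hD n).trans ?_
  have h6 : c * ((n : ℝ)⁻¹ * g n) ≤ g n / 2 := by
    rw [← mul_assoc, ← div_eq_mul_inv]
    have : c / n ≤ 1 / 2 := by
      rw [div_le_div_iff₀ hnpos two_pos]; linarith
    nlinarith [hg0 n]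
  simp only [h] at hn
  linarith

end

/-- The effect on Fourier coefficients of multiplication by `cos (s θ)`. -/
noncomputable def cosShift (s : ℤ) (f : ℤ → ℝ) (m : ℤ) : ℝ := (f (m - s) + f (m + s)) / 2

lemma commute_cosShift (s t : ℤ) : Function.Commute (cosShift s) (cosShift t) := by
  intro f
  funext m
  simp only [cosShift]
  rw [show m - s - t = m - t - s by ring, show m - s + t = m + t - s by ring,
    show m + s - t = m - t + s by ring, show m + s + t = m + t + s by ring]
  ring

/-- The Fourier coefficient of `cos (m θ)` in `cos θ ^ l * cos (2 θ) ^ k`, that is, the mean of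
`cos (m θ) * cos θ ^ l * cos (2 θ) ^ k` over a period. -/
noncomputable def cosMoment (l k : ℕ) : ℤ → ℝ :=
  (cosShift 1)^[l] ((cosShift 2)^[k] fun m => if m = 0 then 1 else 0)

lemma cosMoment_zero_zero (m : ℤ) : cosMoment 0 0 m = if m = 0 then 1 else 0 := rfl

lemma cosMoment_succ_left (l k : ℕ) (m : ℤ) :
    cosMoment (l + 1) k m = (cosMoment l k (m - 1) + cosMoment l k (m + 1)) / 2 := by
  rw [cosMoment, Function.iterate_succ_apply']
  rfl

lemma cosMoment_succ_right (l k : ℕ) (m : ℤ) :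
    cosMoment l (k + 1) m = (cosMoment l k (m - 2) + cosMoment l k (m + 2)) / 2 := by
  rw [cosMoment, Function.iterate_succ_apply', ((commute_cosShift 1 2).iterate_left l).eq]
  rfl

lemma cosMoment_neg (l k : ℕ) (m : ℤ) : cosMoment l k (-m) = cosMoment l k m := by
  induction l generalizing m with
  | zero =>
    induction k generalizing m with
    | zero => simp [cosMoment_zero_zero]
    | succ k ih =>
      rw [cosMoment_succ_right, cosMoment_succ_right, ← ih (m - 2), ← ih (m + 2), add_comm]
      congr 3 <;> ring
  | succ l ih =>
    rw [cosMoment_succ_left, cosMoment_succ_left, ← ih (m - 1), ← ih (m + 1), add_comm]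
    congr 3 <;> ring

lemma cosMoment_natAbs (l k : ℕ) (m : ℤ) : cosMoment l k m.natAbs = cosMoment l k m := by
  rcases Int.natAbs_eq m with h | h
  · rw [← h]
  · conv_rhs => rw [h, cosMoment_neg]

lemma mul_cosMoment (l k : ℕ) (m : ℤ) :
    m * cosMoment l k m =
      l / 2 * (cosMoment (l - 1) k (m - 1) - cosMoment (l - 1) k (m + 1)) +
      k * (cosMoment l (k - 1) (m - 2) - cosMoment l (k - 1) (m + 2)) := by
  induction l generalizing m with
  | zero =>
    induction k generalizing m with
    | zero => simp [cosMoment_zero_zero]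
    | succ k ih =>
      have h1 := ih (m - 2)
      have h2 := ih (m + 2)
      rw [cosMoment_succ_right, Nat.add_sub_cancel]
      have e : (k : ℝ) * (cosMoment 0 k (m - 2) - cosMoment 0 k (m + 2)) =
          k / 2 * (cosMoment 0 (k - 1) (m - 2 - 2) - cosMoment 0 (k - 1) (m + 2 + 2)) := by
        cases k with
        | zero => simp
        | succ k =>
          rw [cosMoment_succ_right, cosMoment_succ_right, Nat.add_sub_cancel]
          rw [show m - 2 + 2 = m by ring, show m + 2 - 2 = m by ring]
          ring
      rw [show m - 2 + 2 = m by ring] at h1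
      rw [show m + 2 - 2 = m by ring] at h2
      push_cast at h1 h2 ⊢
      linear_combination h1 / 2 + h2 / 2 - e
  | succ l ih =>
    have h1 := ih (m - 1)
    have h2 := ih (m + 1)
    rw [cosMoment_succ_left, Nat.add_sub_cancel]
    have e : (l : ℝ) / 2 * (cosMoment l k (m - 1) - cosMoment l k (m + 1)) =
        l / 4 * (cosMoment (l - 1) k (m - 1 - 1) - cosMoment (l - 1) k (m + 1 + 1)) := by
      cases l with
      | zero => simp
      | succ l =>
        rw [cosMoment_succ_left, cosMoment_succ_left, Nat.add_sub_cancel]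
        rw [show m - 1 + 1 = m by ring, show m + 1 - 1 = m by ring]
        ring
    rw [show m - 1 + 1 = m by ring] at h1
    rw [show m + 1 - 1 = m by ring] at h2
    rw [cosMoment_succ_left l, cosMoment_succ_left l]
    rw [show m - 2 - 1 = m - 1 - 2 by ring, show m - 2 + 1 = m + 1 - 2 by ring,
      show m + 2 - 1 = m - 1 + 2 by ring, show m + 2 + 1 = m + 1 + 2 by ring]
    push_cast at h1 h2 ⊢
    linear_combination h1 / 2 + h2 / 2 - e

lemma cosMoment_recurrence (l k : ℕ) (m : ℤ) :
    -((l : ℝ) + k - 1) * (m * cosMoment l k m) =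
      l / 2 * ((1 - m) * cosMoment (l - 1) k (m - 1) - (1 + m) * cosMoment (l - 1) k (m + 1)) +
      k / 2 * ((2 - m) * cosMoment l (k - 1) (m - 2) -
        (2 + m) * cosMoment l (k - 1) (m + 2)) := by
  have h := mul_cosMoment l k m
  have h1 : (l : ℝ) * cosMoment l k m =
      l / 2 * (cosMoment (l - 1) k (m - 1) + cosMoment (l - 1) k (m + 1)) := by
    cases l with
    | zero => simp
    | succ l => rw [cosMoment_succ_left, Nat.add_sub_cancel]; ring
  have h2 : (k : ℝ) * cosMoment l k m =
      k / 2 * (cosMoment l (k - 1) (m - 2) + cosMoment l (k - 1) (m + 2)) := by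
    cases k with
    | zero => simp
    | succ k => rw [cosMoment_succ_right, Nat.add_sub_cancel]; ring
  linear_combination h - m * h1 - m * h2

lemma cosMoment_succ_right' (l k : ℕ) (m : ℤ) :
    cosMoment l (k + 1) m = 2 * cosMoment (l + 2) k m - cosMoment l k m := by
  rw [cosMoment_succ_right, cosMoment_succ_left, cosMoment_succ_left, cosMoment_succ_left]
  rw [show m - 1 - 1 = m - 2 by ring, show m - 1 + 1 = m by ring, show m + 1 - 1 = m by ring,
    show m + 1 + 1 = m + 2 by ring]
  ring

lemma two_pow_mul_cosMoment (l : ℕ) :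
    (∀ j : ℕ, 2 ^ l * cosMoment l 0 (2 * j - l) = l.choose j) ∧
      ∀ j : ℕ, cosMoment l 0 (-(2 * (j + 1)) - l) = 0 := by
  induction l with
  | zero =>
    refine ⟨fun j => ?_, fun j => ?_⟩
    · cases j with
      | zero => simp [cosMoment_zero_zero]
      | succ j =>
        rw [cosMoment_zero_zero, if_neg (by push_cast; omega)]
        simp
    · rw [cosMoment_zero_zero, if_neg (by push_cast; omega)]
  | succ l ih =>
    refine ⟨fun j => ?_, fun j => ?_⟩
    · rw [cosMoment_succ_left]
      cases j with
      | zero =>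
        have h1 := ih.1 0
        have h2 := ih.2 0
        rw [show 2 * ((0 : ℕ) : ℤ) - ((l + 1 : ℕ) : ℤ) - 1 = -(2 * (((0 : ℕ) : ℤ) + 1)) - l by
          push_cast; ring, h2, show 2 * ((0 : ℕ) : ℤ) - ((l + 1 : ℕ) : ℤ) + 1 = 2 * (0 : ℕ) - l by
          push_cast; ring]
        simp only [Nat.choose_zero_right] at h1 ⊢
        rw [pow_succ]
        linear_combination h1
      | succ j =>
        have h1 := ih.1 j
        have h2 := ih.1 (j + 1)
        rw [show 2 * ((j + 1 : ℕ) : ℤ) - ((l + 1 : ℕ) : ℤ) - 1 = 2 * (j : ℤ) - l by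
          push_cast; ring, show 2 * ((j + 1 : ℕ) : ℤ) - ((l + 1 : ℕ) : ℤ) + 1 =
          2 * ((j + 1 : ℕ) : ℤ) - l by push_cast; ring, Nat.choose_succ_succ, pow_succ]
        push_cast at h1 h2 ⊢
        linear_combination h1 + h2
    · have h1 := ih.2 j
      have h2 := ih.2 (j + 1)
      rw [cosMoment_succ_left]
      rw [show -(2 * ((j : ℤ) + 1)) - ((l + 1 : ℕ) : ℤ) - 1 = -(2 * (((j + 1 : ℕ) : ℤ) + 1)) - l by
        push_cast; ring, show -(2 * ((j : ℤ) + 1)) - ((l + 1 : ℕ) : ℤ) + 1 = -(2 * ((j : ℤ) + 1)) - l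
        by push_cast; ring, h1, h2]
      simp

lemma cosMoment_even (i : ℕ) : cosMoment (2 * i) 0 0 = (2 * i).choose i / 4 ^ i := by
  have h := (two_pow_mul_cosMoment (2 * i)).1 i
  rw [show 2 * (i : ℤ) - (2 * i : ℕ) = 0 by push_cast; ring, pow_mul] at h
  rw [eq_div_iff (by positivity), mul_comm, ← h]
  norm_num

/-- The binomial expansion of `cosMoment` at frequency zero. -/
lemma cosMoment_eq_sum (l k : ℕ) (hl : Even l) :
    cosMoment l k 0 = (-1) ^ k / 2 ^ l * ∑ j ∈ range (k + 1),
      ((2 * j + l).choose (j + l / 2) : ℝ) * (k.choose j : ℝ) * ((-2 : ℝ)⁻¹) ^ j := by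
  have hgen : ∀ k l m, cosMoment l k m = (-1) ^ k * ∑ j ∈ range (k + 1),
      (k.choose j : ℝ) * (-2) ^ j * cosMoment (l + 2 * j) 0 m := by
    intro k
    induction k with
    | zero => simp
    | succ k ih =>
      intro l m
      rw [cosMoment_succ_right', ih, ih]
      rw [sum_range_succ' _ (k + 1)]
      simp only [Nat.choose_succ_succ, Nat.cast_add, add_mul, sum_add_distrib]
      rw [sum_range_succ (fun j => (k.choose (j + 1) : ℝ) * (-2) ^ (j + 1) *
        cosMoment (l + 2 * (j + 1)) 0 m) k, Nat.choose_succ_self]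
      rw [sum_range_succ' (fun j => (k.choose j : ℝ) * (-2) ^ j * cosMoment (l + 2 * j) 0 m) k]
      have e : ∑ j ∈ range (k + 1), (k.choose j : ℝ) * (-2) ^ (j + 1) *
          cosMoment (l + 2 * (j + 1)) 0 m = -2 * ∑ j ∈ range (k + 1),
          (k.choose j : ℝ) * (-2) ^ j * cosMoment (l + 2 + 2 * j) 0 m := by
        rw [mul_sum]
        refine sum_congr rfl fun j _ => ?_
        rw [show l + 2 * (j + 1) = l + 2 + 2 * j by ring, pow_succ]
        ring
      rw [e, pow_succ]
      simp only [Nat.choose_zero_right, Nat.cast_zero, Nat.cast_one]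
      ring
  obtain ⟨r, rfl⟩ := hl
  rw [hgen, div_mul_eq_mul_div, mul_div_assoc, sum_div]
  congr 1
  refine sum_congr rfl fun j _ => ?_
  rw [show r + r + 2 * j = 2 * (j + r) by ring, cosMoment_even,
    show 2 * j + (r + r) = 2 * (j + r) by ring, show j + (r + r) / 2 = j + r by omega,
    ← two_mul, pow_mul, pow_add]
  have h : ((-2 : ℝ)⁻¹) ^ j = (-2) ^ j / 4 ^ j := by
    rw [← div_pow]; norm_num
  rw [h]
  norm_num
  field_simp

/-- The limit of the scaled mixed derivatives of a single centred statistic. -/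
noncomputable def limD (β α δ : ℝ) (m l k : ℕ) : ℝ :=
  if l + k = 0 then ellMean β α δ m / β
  else (β / 2 - 1) / β * (-1) ^ (l + k - 1) * (Nat.factorial (l + k - 1) : ℝ) *
    (-1 / (2 * β)) ^ l * (1 / (4 * β)) ^ k * (m * cosMoment l k m)

lemma ellMean_add_two (β α δ : ℝ) (s : ℕ) : ellMean β α δ (s + 2) = ellMean β α δ s := by
  simp [ellMean, pow_add, Nat.even_add]

lemma limD_recurrence_of_two_le {β : ℝ} (hβ : β ≠ 0) (α δ : ℝ) (m l k : ℕ) (hlk : 2 ≤ l + k) :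
    limD β α δ m l k =
      ∑ p ∈ range 2,
        (((((p + 1 : ℕ) : ℤ) - m).sign : ℝ) *
          shiftOp β (p + 1) (limD β α δ ((m : ℤ) - (p + 1 : ℕ)).natAbs) l k -
          shiftOp β (p + 1) (limD β α δ (m + (p + 1))) l k) := by
  let G : ℕ → ℕ → ℝ := fun l k => (β / 2 - 1) / β * (-1) ^ (l + k - 1) *
    (Nat.factorial (l + k - 1) : ℝ) * (-1 / (2 * β)) ^ l * (1 / (4 * β)) ^ k
  have hG : ∀ m l k, l + k ≠ 0 → limD β α δ m l k = G l k * (m * cosMoment l k m) := by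
    intro m l k h
    rw [limD, if_neg h]
  have hl : -(l / (4 * β)) * G (l - 1) k * ((l : ℝ) + k - 1) = -(l / 2) * G l k := by
    cases l with
    | zero => simp
    | succ l =>
      obtain ⟨r, hr⟩ : ∃ r, l + k = r + 1 := ⟨l + k - 1, by omega⟩
      have hr' : (l : ℝ) + k = r + 1 := by exact_mod_cast hr
      simp only [G, Nat.add_sub_cancel]
      rw [show l + 1 + k - 1 = r + 1 by omega, show l + k - 1 = r by omega, Nat.factorial_succ]
      push_cast
      rw [show (l : ℝ) + 1 + k - 1 = r + 1 by linarith, pow_succ, pow_succ]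
      field_simp
      ring
  have hk : k / (8 * β) * G l (k - 1) * ((l : ℝ) + k - 1) = -(k / 2) * G l k := by
    cases k with
    | zero => simp
    | succ k =>
      obtain ⟨r, hr⟩ : ∃ r, l + k = r + 1 := ⟨l + k - 1, by omega⟩
      have hr' : (l : ℝ) + k = r + 1 := by exact_mod_cast hr
      simp only [G, Nat.add_sub_cancel]
      rw [show l + (k + 1) - 1 = r + 1 by omega, show l + k - 1 = r by omega, Nat.factorial_succ]
      push_cast
      rw [show (l : ℝ) + (k + 1) - 1 = r + 1 by linarith, pow_succ, pow_succ (1 / (4 * β))]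
      field_simp
      ring
  have s1 : ∀ m, shiftOp β 1 (limD β α δ m) l k =
      -(l / (4 * β)) * G (l - 1) k * (m * cosMoment (l - 1) k m) := by
    intro m
    simp only [shiftOp, if_true]
    cases l with
    | zero => simp
    | succ l => rw [hG _ _ _ (by omega)]; ring
  have s2 : ∀ m, shiftOp β 2 (limD β α δ m) l k =
      k / (8 * β) * G l (k - 1) * (m * cosMoment l (k - 1) m) := by
    intro m
    simp only [shiftOp, if_true]
    cases k with
    | zero => simp
    | succ k =>
      rw [if_neg (by norm_num), Nat.add_sub_cancel, hG m l k (by omega)]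
      ring
  have hs : ∀ (p : ℕ) (c : ℝ) (f : ℤ → ℝ), (∀ a : ℤ, f a.natAbs = f a) →
      ((((p : ℤ) - m).sign : ℤ) : ℝ) *
      (c * ((((m : ℤ) - p).natAbs : ℕ) * f (((m : ℤ) - p).natAbs : ℕ))) = c * ((p - m) * f (m - p)) := by
    intro p c f hf
    rw [hf]
    have h1 : ((((p : ℤ) - m).sign : ℤ) : ℝ) * (((m : ℤ) - p).natAbs : ℕ) = (p : ℝ) - m := by
      have := Int.sign_mul_natAbs ((p : ℤ) - m)
      rw [← Int.natAbs_neg, neg_sub] at this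
      have h := congrArg (Int.cast : ℤ → ℝ) this
      rw [Int.cast_mul, Int.cast_sub, Int.cast_natCast, Int.cast_natCast, Int.cast_natCast] at h
      exact h
    linear_combination c * f (m - p) * h1
  have h3 : ∀ f : ℕ → ℝ, ∑ p ∈ range 2, f p = f 0 + f 1 := fun f => by simp [sum_range_succ]
  rw [h3, hG _ _ _ (by omega)]
  simp only [zero_add, s1, s2, show 1 + 1 = 2 from rfl]
  rw [hs 1 _ _ (cosMoment_natAbs _ _), hs 2 _ _ (cosMoment_natAbs _ _)]
  have hrec := cosMoment_recurrence l k m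
  have hq : ((l : ℝ) + k - 1) ≠ 0 := by
    have : (2 : ℝ) ≤ (l : ℝ) + k := by exact_mod_cast hlk
    intro h
    linarith
  apply mul_left_cancel₀ hq
  push_cast at hrec ⊢
  linear_combination (-G l k) * hrec -
    ((1 - m) * cosMoment (l - 1) k (m - 1) - (m + 1) * cosMoment (l - 1) k (m + 1)) * hl -
    ((2 - m) * cosMoment l (k - 1) (m - 2) - (m + 2) * cosMoment l (k - 1) (m + 2)) * hk

lemma limD_recurrence {β : ℝ} (hβ : β ≠ 0) (α δ : ℝ) (M l k : ℕ) :
    β * limD β α δ (M + 1) l k =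
      ellCoef β α δ (M + 1) 0 * (if l + k = 0 then 1 else 0) +
      ∑ i ∈ range (M + 1), ellCoef β α δ (M + 1) (i + 1) *
        shiftOp β (i + 1) (fun l k => if l + k = 0 then 1 else 0) l k +
      β * ∑ p ∈ range 2,
        (((((p + 1 : ℕ) : ℤ) - (M + 1 : ℕ)).sign : ℝ) *
          shiftOp β (p + 1) (limD β α δ (((M + 1 : ℕ) : ℤ) - (p + 1 : ℕ)).natAbs) l k -
          shiftOp β (p + 1) (limD β α δ (M + 1 + (p + 1))) l k) := by
  by_cases h2 : 2 ≤ l + k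
  · have e : ∀ p, shiftOp β p (fun l k => if l + k = 0 then 1 else 0) l k = 0 := by
      intro p
      have z1 : (l : ℝ) * (if l - 1 + k = 0 then 1 else 0) = 0 := by
        cases l with
        | zero => simp
        | succ l => rw [if_neg (by omega), mul_zero]
      have z2 : (k : ℝ) * (if l + (k - 1) = 0 then 1 else 0) = 0 := by
        cases k with
        | zero => simp
        | succ k => rw [if_neg (by omega), mul_zero]
      simp only [shiftOp, neg_mul, div_mul_eq_mul_div, z1, z2, zero_div, neg_zero, ite_self]
    rw [limD_recurrence_of_two_le hβ α δ (M + 1) l k h2, if_neg (by omega)]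
    simp only [e, mul_zero, sum_const_zero, zero_add]
  · have h3 : ∀ f : ℕ → ℝ, ∑ p ∈ range 2, f p = f 0 + f 1 := fun f => by simp [sum_range_succ]
    have hcases : (l = 0 ∧ k = 0) ∨ (l = 1 ∧ k = 0) ∨ (l = 0 ∧ k = 1) := by omega
    rcases hcases with ⟨rfl, rfl⟩ | ⟨rfl, rfl⟩ | ⟨rfl, rfl⟩
    · simp [shiftOp, limD, ellCoef]
      field_simp
    · rw [sum_eq_single 0 (by intro b _ hb; simp [shiftOp, hb]) (by simp)]
      rw [h3]
      simp only [limD, shiftOp, cosMoment_succ_left, cosMoment_zero_zero]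
      match M with
      | 0 =>
        simp [ellCoef, ellMean]
        field_simp
        ring
      | M + 1 =>
        have s : (((0 + 1 : ℕ) : ℤ) - (M + 1 + 1 : ℕ)).sign = -1 :=
          Int.sign_eq_neg_one_of_neg (by omega)
        have e : (((M + 1 + 1 : ℕ) : ℤ) - (0 + 1 : ℕ)).natAbs = M + 1 := by omega
        rw [s, e, if_neg (show ¬ (((M + 1 + 1 : ℕ) : ℤ) - 1 = 0) by omega),
          if_neg (show ¬ (((M + 1 + 1 : ℕ) : ℤ) + 1 = 0) by omega)]
        have e2 := ellMean_add_two β α δ (M + 1)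
        simp [ellCoef, e2]
        field_simp
        ring
    · have e1 : ∑ i ∈ range (M + 1), ellCoef β α δ (M + 1) (i + 1) *
          shiftOp β (i + 1) (fun l k => if l + k = 0 then 1 else 0) 0 1 =
          if M = 0 then 0 else ellCoef β α δ (M + 1) 2 * (1 / (8 * β)) := by
        split_ifs with hM
        · subst hM; simp [shiftOp]
        · rw [sum_eq_single 1 (by intro b _ hb; simp [shiftOp, hb])
            (by intro h; rw [mem_range] at h; omega)]
          simp [shiftOp]
      rw [h3, e1]
      simp only [limD, shiftOp, cosMoment_succ_right, cosMoment_zero_zero]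
      match M with
      | 0 =>
        have e2 := ellMean_add_two β α δ 1
        simp [e2]
      | 1 =>
        simp [ellCoef, ellMean, show Even 4 by decide]
        field_simp
        ring
      | M + 2 =>
        have s : (((1 + 1 : ℕ) : ℤ) - (M + 2 + 1 : ℕ)).sign = -1 :=
          Int.sign_eq_neg_one_of_neg (by omega)
        have e : (((M + 2 + 1 : ℕ) : ℤ) - (1 + 1 : ℕ)).natAbs = M + 1 := by omega
        rw [s, e, if_neg (show ¬ (((M + 2 + 1 : ℕ) : ℤ) - 2 = 0) by omega),
          if_neg (show ¬ (((M + 2 + 1 : ℕ) : ℤ) + 2 = 0) by omega)]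
        have e2 : ellMean β α δ (M + 2 + 1 + (1 + 1)) = ellMean β α δ (M + 1) := by
          rw [show M + 2 + 1 + (1 + 1) = M + 1 + 2 + 2 by ring, ellMean_add_two, ellMean_add_two]
        have e3 : M + 2 + 1 - 2 = M + 1 := by omega
        simp [ellCoef, e2, e3]
        field_simp
        ring

/-- Convergence of the scaled mixed derivatives of a single centred statistic. -/
theorem tendsto_momD_singleton {β α δ : ℝ} (hβ : 1 ≤ β) (hα : -1 < α) (hδ : -2 < δ) (m l k : ℕ)
    (hm : m ≠ 0) :
    Tendsto (fun n => momD β α δ n {m} l k) atTop (nhds (limD β α δ m l k)) := by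
  induction hq : l + k using Nat.strong_induction_on generalizing m l k with
  | _ q ih =>
  obtain ⟨M, rfl⟩ := Nat.exists_eq_succ_of_ne_zero hm
  have hβ0 : 0 ≤ β := zero_le_one.trans hβ
  have hβ' : β ≠ 0 := by positivity
  have hshift : ∀ p m, m ≠ 0 → Tendsto (fun n => shiftOp β p (momD β α δ n {m}) l k) atTop
      (nhds (shiftOp β p (limD β α δ m) l k)) := by
    intro p m hm
    unfold shiftOp
    split_ifs with h1 h2
    · rcases Nat.eq_zero_or_pos l with rfl | hl
      · simp
      · exact (ih _ (by omega) m _ _ hm rfl).const_mul _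
    · rcases Nat.eq_zero_or_pos k with rfl | hl
      · simp
      · exact (ih _ (by omega) m _ _ hm rfl).const_mul _
    · exact tendsto_const_nhds
  have hsmall : ∀ S : Multiset ℕ, 0 ∉ S →
      Tendsto (fun n : ℕ => (n : ℝ)⁻¹ * momD β α δ n S l k) atTop (nhds 0) := by
    intro S hS
    have h1 := (Asymptotics.isBigO_refl (fun n : ℕ => (n : ℝ)⁻¹) atTop).mul
      (momD_isBigO_one hβ hα hδ l k S hS)
    refine h1.trans_tendsto ?_
    simpa using tendsto_inv_atTop_nhds_zero_nat (𝕜 := ℝ)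
  have key : Tendsto (fun n => β * momD β α δ n {M + 1} l k) atTop
      (nhds (β * limD β α δ (M + 1) l k)) := by
    rw [limD_recurrence hβ' α δ M l k]
    have hloop : ∀ n : ℕ, n ≠ 0 → β * momD β α δ n {M + 1} l k =
        ellCoef β α δ (M + 1) 0 * (if l + k = 0 then 1 else 0) +
        ∑ i ∈ range (M + 1), ellCoef β α δ (M + 1) (i + 1) *
          shiftOp β (i + 1) (fun l k => if l + k = 0 then 1 else 0) l k +
        β * ∑ p ∈ range 2,
          (((((p + 1 : ℕ) : ℤ) - (M + 1 : ℕ)).sign : ℝ) *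
            shiftOp β (p + 1) (momD β α δ n {(((M + 1 : ℕ) : ℤ) - (p + 1 : ℕ)).natAbs}) l k -
            shiftOp β (p + 1) (momD β α δ n {M + 1 + (p + 1)}) l k) +
        (-β * ∑ i ∈ range M, (n : ℝ)⁻¹ * momD β α δ n {i + 1, M - i} l k +
          ∑ i ∈ range (M + 1), ellCoef β α δ (M + 1) (i + 1) *
            ((n : ℝ)⁻¹ * momD β α δ n {i + 1} l k)) := by
      intro n hn
      have h := momD_loop hβ hα hδ hn M 0 l k
      have he : momD β α δ n 0 = fun l k => if l + k = 0 then 1 else 0 :=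
        funext fun l => funext fun k => momD_empty hβ0 hα hδ n l k
      rw [he] at h
      simp only [Multiset.map_zero, Multiset.sum_zero, add_zero] at h
      refine h.trans ?_
      congr 1
      simp only [mul_add, mul_sum, mul_left_comm (n : ℝ)⁻¹]
      rfl
    refine Tendsto.congr' ((eventually_ne_atTop 0).mono fun n hn => (hloop n hn).symm) ?_
    conv => arg 3; rw [← add_zero (_ + _)]
    refine Tendsto.add (Tendsto.add tendsto_const_nhds ?_) ?_
    · refine Tendsto.const_mul _ (tendsto_finsetSum _ fun p _ => Tendsto.sub ?_ ?_)
      · by_cases hp : M + 1 = p + 1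
        · simp [hp]
        · exact (hshift _ _ (by omega)).const_mul _
      · exact hshift _ _ (by omega)
    · have h0 : (0 : ℝ) = -β * ∑ i ∈ range M, 0 +
        ∑ i ∈ range (M + 1), ellCoef β α δ (M + 1) (i + 1) * 0 := by simp
      rw [h0]
      refine Tendsto.add (Tendsto.const_mul _ (tendsto_finsetSum _ fun i hi => hsmall _ ?_))
        (tendsto_finsetSum _ fun i hi => (hsmall _ ?_).const_mul _)
      · rw [mem_range] at hi
        simp
        omega
      · simp
  have h := key.const_mul β⁻¹
  simpa only [inv_mul_cancel_left₀ hβ'] using h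

lemma tiltInt_affine_chebStat_div {β α δ : ℝ} (hβ : 0 ≤ β) (hα : -1 < α) (hδ : -2 < δ) (n p : ℕ)
    (a b z w : ℝ) :
    tiltInt β α δ (fun T : Fin n → ℝ => a + b * chebStat p T) z w /
        tiltInt β α δ (fun _ : Fin n → ℝ => 1) z w =
      a + b * tiltShift β p z w + b * centMoment β α δ n {p} z w := by
  have h : (fun T : Fin n → ℝ => a + b * chebStat p T) =
      fun T => b * centProd β z w {p} T + (a + b * tiltShift β p z w) * 1 := by
    funext T
    simp only [centProd, Multiset.map_singleton, Multiset.prod_singleton]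
    ring
  rw [h, tiltInt_add hβ hα hδ (by fun_prop) (by fun_prop), tiltInt_const_mul, tiltInt_const_mul,
    centMoment]
  have := (tiltInt_one_pos (n := n) hβ hα hδ z w).ne'
  field_simp
  ring

lemma sum_eq_chebStat {n : ℕ} (T : Fin n → ℝ) :
    ∑ j, T j = n / 2 + 1 / 2 * chebStat 1 T := by
  have h : ∀ j, T j = 1 / 2 + 1 / 2 * (Polynomial.Chebyshev.T ℝ (1 : ℕ)).eval (2 * T j - 1) := by
    intro j
    simp
    ring
  rw [sum_congr rfl fun j _ => h j, sum_add_distrib, ← mul_sum, chebStat]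
  simp
  ring

lemma sum_mul_one_sub_eq_chebStat {n : ℕ} (T : Fin n → ℝ) :
    ∑ j, T j * (1 - T j) = n / 8 + -(1 / 8) * chebStat 2 T := by
  have h : ∀ j, T j * (1 - T j) =
      1 / 8 + -(1 / 8) * (Polynomial.Chebyshev.T ℝ (2 : ℕ)).eval (2 * T j - 1) := by
    intro j
    simp [Polynomial.Chebyshev.T_two]
    ring
  rw [sum_congr rfl fun j _ => h j, sum_add_distrib, ← mul_sum, chebStat]
  simp
  ring

lemma sigJoint_eq (β α δ : ℝ) (n : ℕ) (z w : ℝ) :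
    sigJoint β α δ n z w = Real.log (tiltInt β α δ (fun _ : Fin n → ℝ => 1) z w /
      tiltInt β α δ (fun _ : Fin n → ℝ => 1) 0 0) := by
  simp [sigJoint, Mjoint, cSel, tiltInt, tilt]

lemma hasFDerivAt_sigJoint {β α δ : ℝ} (hβ : 0 ≤ β) (hα : -1 < α) (hδ : -2 < δ) (n : ℕ)
    (q : ℝ × ℝ) :
    HasFDerivAt (fun q : ℝ × ℝ => sigJoint β α δ n q.1 q.2)
      (-(n / 2 + 1 / 2 * tiltShift β 1 q.1 q.2 + 1 / 2 * centMoment β α δ n {1} q.1 q.2) •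
          ContinuousLinearMap.fst ℝ ℝ ℝ -
        (n / 8 + -(1 / 8) * tiltShift β 2 q.1 q.2 + -(1 / 8) * centMoment β α δ n {2} q.1 q.2) •
          ContinuousLinearMap.snd ℝ ℝ ℝ) q := by
  simp only [sigJoint_eq, ← tiltInt_affine_chebStat_div hβ hα hδ, ← sum_eq_chebStat,
    ← sum_mul_one_sub_eq_chebStat]
  have h0 := (tiltInt_one_pos (n := n) hβ hα hδ 0 0).ne'
  have h1 := (tiltInt_one_pos (n := n) hβ hα hδ q.1 q.2).ne'
  have h := ((hasFDerivAt_tiltInt hβ hα hδ (F := fun _ : Fin n → ℝ => 1) (by fun_prop) q).mul_const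
    (tiltInt β α δ (fun _ : Fin n → ℝ => 1) 0 0)⁻¹).log (mul_ne_zero h1 (inv_ne_zero h0))
  simp only [← div_eq_mul_inv, mul_one] at h
  refine h.congr_fderiv ?_
  ext
  · simp
    field_simp
  · simp
    field_simp

lemma deriv_sigJoint_fst {β α δ : ℝ} (hβ : 0 ≤ β) (hα : -1 < α) (hδ : -2 < δ) (n : ℕ) (w : ℝ) :
    deriv (fun z => sigJoint β α δ n z w) = fun z =>
      -(n / 2) + -(1 / 2) * tiltShift β 1 z w + -(1 / 2) * centMoment β α δ n {1} z w := by
  funext z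
  have h : HasDerivAt (fun z : ℝ => (z, w)) ((1 : ℝ), (0 : ℝ)) z :=
    (hasDerivAt_id _).prodMk (hasDerivAt_const _ _)
  refine ((hasFDerivAt_sigJoint hβ hα hδ n (z, w)).comp_hasDerivAt z h).deriv.trans ?_
  simp
  ring

lemma deriv_sigJoint_snd {β α δ : ℝ} (hβ : 0 ≤ β) (hα : -1 < α) (hδ : -2 < δ) (n : ℕ) (z : ℝ) :
    deriv (fun w => sigJoint β α δ n z w) = fun w =>
      -(n / 8) + 1 / 8 * tiltShift β 2 z w + 1 / 8 * centMoment β α δ n {2} z w := by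
  funext w
  have h : HasDerivAt (fun w : ℝ => (z, w)) ((0 : ℝ), (1 : ℝ)) w :=
    (hasDerivAt_const _ _).prodMk (hasDerivAt_id _)
  refine ((hasFDerivAt_sigJoint hβ hα hδ n (z, w)).comp_hasDerivAt w h).deriv.trans ?_
  simp
  ring

lemma mixD_const (a : ℝ) {l k : ℕ} (h : l + k ≠ 0) : mixD l k (fun _ _ => a) = 0 := by
  unfold mixD
  simp only [iteratedDeriv_const]
  split_ifs
  · omega
  · rfl
  · rfl

lemma mixD_affine_centMoment {β α δ : ℝ} (hβ : 0 ≤ β) (hα : -1 < α) (hδ : -2 < δ) (n p : ℕ)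
    (a b : ℝ) {l k : ℕ} (hlk : 2 ≤ l + k) :
    mixD l k (fun z w => a + b * tiltShift β p z w + b * centMoment β α δ n {p} z w) =
      b * mixD l k (centMoment β α δ n {p}) := by
  have hc : ∀ c : ℝ, (fun _ _ => c : ℝ → ℝ → ℝ) ∈ smoothTwo := fun c =>
    mem_smoothTwo.2 contDiff_const
  have hm := mem_smoothTwo.2 (contDiff_centMoment hβ hα hδ n {p})
  have h : mixD l k (fun z w => a + b * (tiltShift β p z w * 1) + b * centMoment β α δ n {p} z w) =
      mixD l k (fun _ _ => a) + b * mixD l k (fun z w => tiltShift β p z w * 1) +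
        b * mixD l k (centMoment β α δ n {p}) := by
    have := map_add (mixDMap l k) (⟨_, hc a⟩ + b • ⟨_, tiltShift_mul_mem_smoothTwo β p (hc 1)⟩)
      (b • ⟨_, hm⟩)
    rw [map_add (mixDMap l k) ⟨_, hc a⟩, map_smul, map_smul] at this
    exact this
  have hs : shiftOp β p (fun l k => mixD l k fun _ _ => 1) l k = 0 := by
    unfold shiftOp
    beta_reduce
    rw [mixD_const _ (by omega), mixD_const _ (by omega)]
    simp
  rw [mixD_tiltShift_mul β p (hc 1), hs, mixD_const a (by omega)] at h
  simpa using h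

lemma kappaJ_succ_right {β α δ : ℝ} (hβ : 0 ≤ β) (hα : -1 < α) (hδ : -2 < δ) (n : ℕ) {l k : ℕ}
    (hlk : 2 ≤ l + k) :
    n ^ (l + k) * kappaJ β α δ l (k + 1) n =
      (-1) ^ (l + k + 1) * (1 / 8 * momD β α δ n {2} l k) := by
  have h := mixD_affine_centMoment hβ hα hδ n 2 (-(n / 8)) (1 / 8) hlk
  rw [momD, kappaJ]
  simp only [iteratedDeriv_succ', deriv_sigJoint_snd hβ hα hδ n]
  rw [mixD] at h
  rw [h]
  ring

lemma kappaJ_succ_left {β α δ : ℝ} (hβ : 0 ≤ β) (hα : -1 < α) (hδ : -2 < δ) (n : ℕ) {l : ℕ}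
    (hl : 2 ≤ l) :
    n ^ l * kappaJ β α δ (l + 1) 0 n =
      (-1) ^ (l + 1) * (-(1 / 2) * momD β α δ n {1} l 0) := by
  have h := mixD_affine_centMoment hβ hα hδ n 1 (-(n / 2)) (-(1 / 2)) (k := 0) hl
  rw [momD, kappaJ]
  simp only [iteratedDeriv_zero, iteratedDeriv_succ', deriv_sigJoint_fst hβ hα hδ n]
  simp only [mixD, iteratedDeriv_zero] at h
  rw [h]
  simp only [mixD, iteratedDeriv_zero, add_zero]
  ring

lemma limD_two_eq {β : ℝ} (hβ : β ≠ 0) (α δ : ℝ) {l k : ℕ} (hl : Even l) (hlk : 2 ≤ l + k) :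
    (-1) ^ (l + k + 1) * (1 / 8 * limD β α δ 2 l k) =
      (β / 2 - 1) * (Nat.factorial (l + k - 1) : ℝ) / ((4 * β) ^ (k + 1) * (4 * β) ^ l) *
        (2 ^ l * cosMoment l (k + 1) 0) := by
  obtain ⟨r, hr⟩ : ∃ r, l + k = r + 1 := ⟨l + k - 1, by omega⟩
  have hc : cosMoment l (k + 1) 0 = cosMoment l k 2 := by
    rw [cosMoment_succ_right, zero_sub, zero_add, cosMoment_neg]
    ring
  rw [limD, if_neg (by omega), hc, hr, Nat.add_sub_cancel, neg_div, hl.neg_pow]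
  have h1 : ((-1 : ℝ) ^ (r + 1 + 1)) * (-1) ^ r = 1 := by
    rw [← pow_add, show r + 1 + 1 + r = 2 * (r + 1) by ring, pow_mul]
    simp
  have h4 : (4 * β) ^ l = 2 ^ l * (2 * β) ^ l := by rw [← mul_pow]; ring
  rw [h4, one_div_pow, one_div_pow, pow_succ (4 * β)]
  push_cast
  field_simp
  linear_combination 8 * (β - 2) * cosMoment l k 2 * h1

lemma limD_one_eq {β : ℝ} (hβ : β ≠ 0) (α δ : ℝ) {l : ℕ} (hl : Even (l + 1)) (hlk : 2 ≤ l) :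
    (-1) ^ (l + 1) * (-(1 / 2) * limD β α δ 1 l 0) =
      (β / 2 - 1) * (Nat.factorial (l - 1) : ℝ) / (4 * β) ^ (l + 1) *
        (2 ^ (l + 1) * cosMoment (l + 1) 0 0) := by
  obtain ⟨r, rfl⟩ : ∃ r, l = r + 1 := ⟨l - 1, by omega⟩
  have hc : cosMoment (r + 1 + 1) 0 0 = cosMoment (r + 1) 0 1 := by
    rw [cosMoment_succ_left, zero_sub, zero_add, cosMoment_neg]
    ring
  have hr : Even r := by simpa [Nat.even_add_one] using hl
  rw [limD, if_neg (by omega), hc]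
  simp only [add_zero, Nat.add_sub_cancel, pow_zero, mul_one, Nat.cast_one, one_mul]
  have h4 : (4 * β) ^ (r + 1 + 1) = 2 ^ (r + 1 + 1) * (2 * β) ^ (r + 1 + 1) := by
    rw [← mul_pow]; ring
  rw [h4, hl.neg_one_pow, hr.neg_one_pow, neg_div, hr.add_one.neg_pow, one_div_pow,
    pow_succ (2 * β) (r + 1)]
  field_simp

/-- Weak localization limit of the mixed cumulants of conductance and shot noise,
even `l`, for `β ∈ {1,4}`. -/
theorem weak_localization_even_mixed_cumulants
    (β α δ : ℝ) (hβ : β = 1 ∨ β = 4) (hα : -1 < α) (hδ : -2 < δ)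
    (l k : ℕ) (hl : Even l)
    (hlk : (l, k) ∉ ({(0, 0), (0, 1), (0, 2), (2, 0)} : Set (ℕ × ℕ))) :
    Tendsto (fun n : ℕ => (n : ℝ) ^ (l + k - 1) * kappaJ β α δ l k n) atTop
      (nhds ((-1 : ℝ) ^ k * (β / 2 - 1) * (Nat.factorial (l + k - 2) : ℝ) /
          ((4 * β) ^ k * (4 * β) ^ l) *
        ∑ j ∈ Finset.range (k + 1),
          (Nat.choose (2 * j + l) (j + l / 2) : ℝ) * (Nat.choose k j : ℝ) *
            ((-2 : ℝ)⁻¹) ^ j)) := by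
  have hβ1 : 1 ≤ β := by rcases hβ with rfl | rfl <;> norm_num
  have hβ0 : 0 ≤ β := zero_le_one.trans hβ1
  have hβ' : β ≠ 0 := by positivity
  have h3 : 3 ≤ l + k := by
    obtain ⟨r, rfl⟩ := hl
    simp only [Set.mem_insert_iff, Set.mem_singleton_iff, Prod.mk.injEq] at hlk
    omega
  have hsum : (2 : ℝ) ^ l * cosMoment l k 0 = (-1) ^ k * ∑ j ∈ range (k + 1),
      ((2 * j + l).choose (j + l / 2) : ℝ) * (k.choose j : ℝ) * ((-2 : ℝ)⁻¹) ^ j := by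
    rw [cosMoment_eq_sum l k hl]
    field_simp
  have hgoal : (-1 : ℝ) ^ k * (β / 2 - 1) * (Nat.factorial (l + k - 2) : ℝ) /
          ((4 * β) ^ k * (4 * β) ^ l) * ∑ j ∈ range (k + 1),
          ((2 * j + l).choose (j + l / 2) : ℝ) * (k.choose j : ℝ) * ((-2 : ℝ)⁻¹) ^ j =
      (β / 2 - 1) * (Nat.factorial (l + k - 2) : ℝ) / ((4 * β) ^ k * (4 * β) ^ l) *
        (2 ^ l * cosMoment l k 0) := by
    rw [hsum]
    ring
  rw [hgoal]
  cases k with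
  | succ k =>
    have h := ((tendsto_momD_singleton hβ1 hα hδ 2 l k two_ne_zero).const_mul (1 / 8)).const_mul
      ((-1) ^ (l + k + 1))
    rw [limD_two_eq hβ' α δ hl (by omega)] at h
    exact h.congr fun n => (kappaJ_succ_right hβ0 hα hδ n (by omega)).symm
  | zero =>
    obtain ⟨l, rfl⟩ : ∃ r, l = r + 1 := ⟨l - 1, by omega⟩
    have h := ((tendsto_momD_singleton hβ1 hα hδ 1 l 0 one_ne_zero).const_mul (-(1 / 2))).const_mul
      ((-1) ^ (l + 1))
    rw [limD_one_eq hβ' α δ hl (by omega)] at h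
    rw [pow_zero, one_mul]
    exact h.congr fun n => (kappaJ_succ_left hβ0 hα hδ n (by omega)).symm
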